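/- arXiv:1103.2239 — 2 statements merged into one kernel-verified Lean document; each statement's English description precedes it below -/
import Mathlib

section
/- Let T be a complete NIP theory. If T is distal, then every generically stable Keisler measure is smooth. More precisely: if μ is a generically stable measure over a |T|⁺-saturated model N, then for every tuple a, the measure μ and the type tp(a/N) are weakly orthogonal, i.e., μ has a unique extension to a measure over Na; hence μ is smooth. -/
/-!
Common model-theoretic definitions: indiscernible sequences, NIP, cuts,
distality, Keisler measures, invariant types, etc., following the paper
"Distal and non-distal NIP theories".
-/

namespace Paper

open FirstOrder Language Set Cardinal

universe u v w

variable (L : FirstOrder.Language.{u, v}) {M : Type w} [L.Structure M]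

/-- `|T| = |L| + ℵ₀`. -/
noncomputable def cardT (L : FirstOrder.Language.{u, v}) : Cardinal.{max u v} :=
  max L.card Cardinal.aleph0

/-- The set of all elements of `M` appearing in the sequence of tuples `I`. -/
def elems {ι γ : Type*} (I : ι → γ → M) : Set M :=
  ⋃ t, Set.range (I t)

/-- The tuples `x` and `y` realize the same complete type over the parameter set `A`. -/
def SameTypeOver {η : Type*} (A : Set M) (x y : η → M) : Prop :=
  ∀ φ : L.Formula (η ⊕ ↥A),
    φ.Realize (Sum.elim x Subtype.val) ↔ φ.Realize (Sum.elim y Subtype.val)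

/-- Indiscernibility of a family of `γ`-tuples along an arbitrary strict ordering
relation `r` on the index set, over the parameter set `A`: any two `r`-increasing
finite tuples of indices yield tuples with the same type over `A`. -/
def IsIndiscernibleAlongOver {ι γ : Type*} (r : ι → ι → Prop) (A : Set M)
    (I : ι → γ → M) : Prop :=
  ∀ (n : ℕ) (s t : Fin n → ι),
    (∀ i j : Fin n, i < j → r (s i) (s j)) →
    (∀ i j : Fin n, i < j → r (t i) (t j)) →
    ∀ φ : L.Formula ((Fin n × γ) ⊕ ↥A),
      (φ.Realize (Sum.elim (fun p => I (s p.1) p.2) Subtype.val) ↔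
       φ.Realize (Sum.elim (fun p => I (t p.1) p.2) Subtype.val))

/-- `I` is an indiscernible sequence over `A`. -/
def IsIndiscernibleOver {ι γ : Type*} [LinearOrder ι] (A : Set M) (I : ι → γ → M) : Prop :=
  IsIndiscernibleAlongOver L (· < ·) A I

/-- `I` is a totally indiscernible (set-indiscernible) sequence over `A`. -/
def IsTotallyIndiscernibleOver {ι γ : Type*} (A : Set M) (I : ι → γ → M) : Prop :=
  ∀ (n : ℕ) (s t : Fin n → ι), Function.Injective s → Function.Injective t →
    ∀ φ : L.Formula ((Fin n × γ) ⊕ ↥A),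
      (φ.Realize (Sum.elim (fun p => I (s p.1) p.2) Subtype.val) ↔
       φ.Realize (Sum.elim (fun p => I (t p.1) p.2) Subtype.val))

/-- The (complete theory of the monster model) `M` is NIP: no formula `φ(x;y)` has an
indiscernible sequence `(a_i)_{i<ω}` and a tuple `b` with `φ(a_i;b)` holding exactly
for even `i`. -/
def IsNIP (M : Type w) [L.Structure M] : Prop :=
  ∀ (n m : ℕ) (φ : L.Formula (Fin n ⊕ Fin m)) (a : ℕ → Fin n → M) (b : Fin m → M),
    IsIndiscernibleOver L (∅ : Set M) a →
    ¬ (∀ i : ℕ, (φ.Realize (Sum.elim (a i) b) ↔ Even i))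

/-- A Dedekind cut of a linearly ordered index set: a lower set whose left part has
infinite cofinality (nonempty with no greatest element) and whose right part has
infinite coinitiality (nonempty with no least element). -/
def IsDedekindCut {ι : Type*} [LinearOrder ι] (c : Set ι) : Prop :=
  IsLowerSet c ∧ c.Nonempty ∧ (∀ x ∈ c, ∃ y ∈ c, x < y) ∧
    (cᶜ).Nonempty ∧ (∀ x ∈ cᶜ, ∃ y ∈ cᶜ, y < x)

/-- The strict ordering on `ι ⊕ κ` obtained by inserting, for each `k : κ`, a new point
into the cut `c k` of the linear order `ι`. -/
def cutRel {ι κ : Type*} [LinearOrder ι] (c : κ → Set ι) :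
    (ι ⊕ κ) → (ι ⊕ κ) → Prop :=
  fun x y =>
    match x, y with
    | Sum.inl i, Sum.inl j => i < j
    | Sum.inl i, Sum.inr k => i ∈ c k
    | Sum.inr k, Sum.inl i => i ∉ c k
    | Sum.inr k, Sum.inr l => c k ⊂ c l

/-- The tuple `b` fills the cut `c` of the sequence `I` (over the parameter set `A`):
the sequence obtained from `I` by inserting `b` into the cut `c` is indiscernible
over `A`. -/
def FillsCut {ι γ : Type*} [LinearOrder ι] (A : Set M) (I : ι → γ → M) (c : Set ι)
    (b : γ → M) : Prop :=
  IsIndiscernibleAlongOver L (cutRel (fun _ : Unit => c)) A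
    (Sum.elim I (fun _ : Unit => b))

/-- The family of tuples `b k` fills the family of cuts `c k` of `I` (over `A`): the
sequence obtained from `I` by inserting every `b k` into its cut `c k` is indiscernible
over `A`. -/
def FillsPolycut {ι γ κ : Type*} [LinearOrder ι] (A : Set M) (I : ι → γ → M)
    (c : κ → Set ι) (b : κ → γ → M) : Prop :=
  IsIndiscernibleAlongOver L (cutRel c) A (Sum.elim I b)

/-- The sequences `I` and `J` have the same EM-type over `A`. -/
def SameEMTypeOver {ι κ γ : Type*} [LinearOrder ι] [LinearOrder κ] (A : Set M)
    (I : ι → γ → M) (J : κ → γ → M) : Prop :=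
  ∀ (n : ℕ) (s : Fin n → ι) (t : Fin n → κ), StrictMono s → StrictMono t →
    ∀ φ : L.Formula ((Fin n × γ) ⊕ ↥A),
      (φ.Realize (Sum.elim (fun p => I (s p.1) p.2) Subtype.val) ↔
       φ.Realize (Sum.elim (fun p => J (t p.1) p.2) Subtype.val))

/-- The indiscernible sequence `I` is distal (over the base parameter set `A`): for
every densely ordered sequence `J` with the same EM-type as `I` over `A`, any two
distinct Dedekind cuts `c₁ ≠ c₂` of `J` and tuples `a`, `b` filling them respectively,
the sequence obtained by inserting both `a` and `b` into their cuts is indiscernible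
over `A`. -/
def IsDistalSeqOver {ι γ : Type*} [LinearOrder ι] (A : Set M) (I : ι → γ → M) : Prop :=
  ∀ (κ : Type w) (_ : LinearOrder κ) (_ : DenselyOrdered κ) (J : κ → γ → M),
    IsIndiscernibleOver L A J → SameEMTypeOver L A I J →
    ∀ c₁ c₂ : Set κ, IsDedekindCut c₁ → IsDedekindCut c₂ → c₁ ≠ c₂ →
    ∀ a b : γ → M, FillsCut L A J c₁ a → FillsCut L A J c₂ b →
      FillsPolycut L A J (fun x : Bool => if x then c₁ else c₂)
        (fun x : Bool => if x then a else b)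

/-- The theory of `M` is distal: every indiscernible sequence (of tuples of any
length) is distal. -/
def TheoryDistal (M : Type w) [L.Structure M] : Prop :=
  ∀ (ι γ : Type w) (_ : LinearOrder ι) (I : ι → γ → M),
    IsIndiscernibleOver L (∅ : Set M) I → IsDistalSeqOver L (∅ : Set M) I

/-- `a` realizes the limit type over `A` of the cut `c` of `I`, polarized from the
left: every formula over `A` holding cofinally-eventually on the left part of the cut
holds of `a`. -/
def RealizesLimLeft {ι γ : Type*} [LinearOrder ι] (A : Set M) (I : ι → γ → M)
    (c : Set ι) (a : γ → M) : Prop :=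
  ∀ φ : L.Formula (γ ⊕ ↥A),
    (∃ t ∈ c, ∀ s ∈ c, t ≤ s → φ.Realize (Sum.elim (I s) Subtype.val)) →
    φ.Realize (Sum.elim a Subtype.val)

/-- `a` realizes the limit type over `A` of the cut `c` of `I`, polarized from the
right. -/
def RealizesLimRight {ι γ : Type*} [LinearOrder ι] (A : Set M) (I : ι → γ → M)
    (c : Set ι) (a : γ → M) : Prop :=
  ∀ φ : L.Formula (γ ⊕ ↥A),
    (∃ t ∈ cᶜ, ∀ s ∈ cᶜ, s ≤ t → φ.Realize (Sum.elim (I s) Subtype.val)) →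
    φ.Realize (Sum.elim a Subtype.val)

/-- An equivalence relation on a linear order with finitely many classes, all convex. -/
def IsFiniteConvexEquiv {ι : Type*} [LinearOrder ι] (E : ι → ι → Prop) : Prop :=
  Equivalence E ∧ (∀ x y z : ι, x ≤ y → y ≤ z → E x z → E x y) ∧
    {s : Set ι | ∃ a : ι, s = {b | E a b}}.Finite

/-- Two sequences are mutually indiscernible over `A`: each is indiscernible over `A`
together with all elements of the other. -/
def MutuallyIndiscernible {ι κ γ δ : Type*} [LinearOrder ι] [LinearOrder κ] (A : Set M)
    (I : ι → γ → M) (J : κ → δ → M) : Prop :=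
  IsIndiscernibleOver L (A ∪ elems J) I ∧ IsIndiscernibleOver L (A ∪ elems I) J

/-- Given an indiscernible sequence of pairs `⟨(a_i, b_i)⟩`, the sequences `(a_i)` and
`(b_i)` are weakly linked over `A`: for all disjoint index sets `S`, `T`, the sequences
`(a_i)_{i ∈ S}` and `(b_i)_{i ∈ T}` are mutually indiscernible over `A`. -/
def WeaklyLinked {ι γ δ : Type*} [LinearOrder ι] (A : Set M)
    (I : ι → γ → M) (J : ι → δ → M) : Prop :=
  ∀ S T : Set ι, Disjoint S T →
    MutuallyIndiscernible L A (fun i : ↥S => I i.1) (fun i : ↥T => J i.1)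

/-- `T` is dp-minimal: it is NIP and for every indiscernible sequence of singletons `I`
and every element `d`, there is a partition of `I` into convex pieces `I₁ + I₂ + I₃`
with `I₂` empty or a single point, such that `I₁` and `I₃` are indiscernible over `d`. -/
def IsDpMinimal (M : Type w) [L.Structure M] : Prop :=
  IsNIP L M ∧
  ∀ (ι : Type w) (_ : LinearOrder ι) (I : ι → M) (d : M),
    IsIndiscernibleOver L (∅ : Set M) (fun i (_ : Unit) => I i) →
    ∃ c e : Set ι, IsLowerSet c ∧ IsLowerSet e ∧ c ⊆ e ∧ (e \ c).Subsingleton ∧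
      IsIndiscernibleOver L ({d} : Set M) (fun i : ↥c => fun _ : Unit => I i.1) ∧
      IsIndiscernibleOver L ({d} : Set M) (fun i : ↥(eᶜ) => fun _ : Unit => I i.1)

/-- `N` is (the universe of) an elementary substructure of `M`, via the Tarski–Vaught
test. -/
def IsElementarySet (N : Set M) : Prop :=
  ∀ (n : ℕ) (φ : L.Formula (Unit ⊕ Fin n)) (c : Fin n → M), (∀ i, c i ∈ N) →
    (∃ a : M, φ.Realize (Sum.elim (fun _ => a) c)) →
    ∃ a ∈ N, φ.Realize (Sum.elim (fun _ => a) c)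

/-- The monster `M` is `κ`-saturated: every finitely satisfiable collection of formulas
in one variable over a parameter set of cardinality `< κ` is realized in `M`. -/
def IsSaturatedOfCard (M : Type w) [L.Structure M] (κ : Cardinal.{max u v w}) : Prop :=
  ∀ C : Set M, Cardinal.lift.{max u v} #↥C < κ →
    ∀ p : Set (L.Formula (Unit ⊕ ↥C)),
      (∀ S ⊆ p, S.Finite → ∃ x : M, ∀ φ ∈ S, φ.Realize (Sum.elim (fun _ => x) Subtype.val)) →
      ∃ x : M, ∀ φ ∈ p, φ.Realize (Sum.elim (fun _ => x) Subtype.val)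

/-- The subset `N` of the monster is `κ`-saturated: every finitely satisfiable
collection of formulas in one variable over a subset of `N` of cardinality `< κ` is
realized in `N`. -/
def SetSaturatedOfCard (N : Set M) (κ : Cardinal.{max u v w}) : Prop :=
  ∀ C : Set M, C ⊆ N → Cardinal.lift.{max u v} #↥C < κ →
    ∀ p : Set (L.Formula (Unit ⊕ ↥C)),
      (∀ S ⊆ p, S.Finite → ∃ x : M, ∀ φ ∈ S, φ.Realize (Sum.elim (fun _ => x) Subtype.val)) →
      ∃ x ∈ N, ∀ φ ∈ p, φ.Realize (Sum.elim (fun _ => x) Subtype.val)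

section GlobalTypes

/-- A complete global type in the variables `γ`: a complete, finitely satisfiable set
of formulas with parameters ranging over all of the monster `M`. -/
def IsCompleteGlobalType {γ : Type*} (p : Set (L.Formula (γ ⊕ M))) : Prop :=
  (∀ φ : L.Formula (γ ⊕ M), φ ∈ p ∨ φ.not ∈ p) ∧
  (∀ S : Set (L.Formula (γ ⊕ M)), S ⊆ p → S.Finite →
    ∃ a : γ → M, ∀ φ ∈ S, φ.Realize (Sum.elim a id))

/-- The global type `p` is invariant over the parameter set `A`. -/
def GInvariantOver {γ : Type*} (p : Set (L.Formula (γ ⊕ M))) (A : Set M) : Prop :=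
  ∀ (k : ℕ) (b b' : Fin k → M), SameTypeOver L A b b' →
    ∀ φ : L.Formula (γ ⊕ Fin k),
      (φ.relabel (Sum.map id b) ∈ p ↔ φ.relabel (Sum.map id b') ∈ p)

/-- The tuple `a` realizes the restriction of the global type `p` to the parameter set
`C`: every formula of `p` whose parameters lie in `C` holds of `a`. -/
def GRealizesRestr {γ : Type*} (p : Set (L.Formula (γ ⊕ M))) (C : Set M)
    (a : γ → M) : Prop :=
  ∀ (k : ℕ) (ψ : L.Formula (γ ⊕ Fin k)) (c : Fin k → M), (∀ i, c i ∈ C) →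
    ψ.relabel (Sum.map id c) ∈ p → ψ.Realize (Sum.elim a c)

/-- The global type `p` is definable over `N`. -/
def GDefinableOver {γ : Type*} (N : Set M) (p : Set (L.Formula (γ ⊕ M))) : Prop :=
  ∀ (k : ℕ) (φ : L.Formula (γ ⊕ Fin k)),
    ∃ ψ : L.Formula (Fin k ⊕ ↥N),
      ∀ b : Fin k → M, (φ.relabel (Sum.map id b) ∈ p ↔ ψ.Realize (Sum.elim b Subtype.val))

/-- The global type `p` is finitely satisfiable in `N`. -/
def GFinSatIn {γ : Type*} (N : Set M) (p : Set (L.Formula (γ ⊕ M))) : Prop :=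
  ∀ φ ∈ p, ∃ a : γ → M, (∀ g, a g ∈ N) ∧ φ.Realize (Sum.elim a id)

/-- `b` is a finite Morley sequence of the global type `p` over the parameter set
`B`: each `b i` realizes the restriction of `p` to `B` together with the previous
elements of the sequence. -/
def FinMorley {γ : Type*} (p : Set (L.Formula (γ ⊕ M))) (B : Set M) {k : ℕ}
    (b : Fin k → γ → M) : Prop :=
  ∀ i : Fin k, GRealizesRestr L p (B ∪ ⋃ j ∈ Set.Iio i, Set.range (b j)) (b i)

/-- Membership of the formula `φ(x₀,…,x_{k-1}; c)` in the power `p^{(k)}` of the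
`A`-invariant global type `p`: every finite Morley sequence of `p` over `A` together
with the parameters `c` realizes `φ`. -/
def MemPow {γ : Type*} (p : Set (L.Formula (γ ⊕ M))) (A : Set M) {k : ℕ} {β : Type*}
    (φ : L.Formula ((Fin k × γ) ⊕ β)) (c : β → M) : Prop :=
  ∀ b : Fin k → γ → M, FinMorley L p (A ∪ Set.range c) b →
    φ.Realize (Sum.elim (fun q => b q.1 q.2) c)

/-- The global `N`-invariant type `p` is interior to `N`: `p^{(ω)}` is both a coheir
(finitely satisfiable in `N`) and an heir of its restriction to `N`. -/
def IsInteriorTo {γ : Type*} (p : Set (L.Formula (γ ⊕ M))) (N : Set M) : Prop :=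
  -- coheir
  (∀ (k m : ℕ) (φ : L.Formula ((Fin k × γ) ⊕ Fin m)) (c : Fin m → M),
     MemPow L p N φ c →
     ∃ b : Fin k → γ → M, (∀ i g, b i g ∈ N) ∧
       φ.Realize (Sum.elim (fun q => b q.1 q.2) c)) ∧
  -- heir
  (∀ (k m m' : ℕ) (φ : L.Formula ((Fin k × γ) ⊕ (Fin m ⊕ Fin m')))
     (c : Fin m → M) (e : Fin m' → M), (∀ i, e i ∈ N) →
     MemPow L p N φ (Sum.elim c e) →
     ∃ c' : Fin m → M, (∀ i, c' i ∈ N) ∧ MemPow L p N φ (Sum.elim c' e))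

end GlobalTypes

section TypesOverSet

/-- A complete type over the parameter set `B` in the variables `γ`. -/
def IsCompleteTypeOver (B : Set M) {γ : Type*} (p : Set (L.Formula (γ ⊕ ↥B))) : Prop :=
  (∀ φ : L.Formula (γ ⊕ ↥B), φ ∈ p ∨ φ.not ∈ p) ∧
  (∀ S : Set (L.Formula (γ ⊕ ↥B)), S ⊆ p → S.Finite →
    ∃ a : γ → M, ∀ φ ∈ S, φ.Realize (Sum.elim a Subtype.val))

/-- The type `p` over `B` is invariant over `A`. -/
def TInvariantOver (B : Set M) {γ : Type*} (p : Set (L.Formula (γ ⊕ ↥B)))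
    (A : Set M) : Prop :=
  ∀ (k : ℕ) (b b' : Fin k → ↥B),
    SameTypeOver L A (fun i => (b i : M)) (fun i => (b' i : M)) →
    ∀ φ : L.Formula (γ ⊕ Fin k),
      (φ.relabel (Sum.map id b) ∈ p ↔ φ.relabel (Sum.map id b') ∈ p)

/-- The tuple `a` realizes the type `p` over `B`. -/
def RealizesType (B : Set M) {γ : Type*} (p : Set (L.Formula (γ ⊕ ↥B)))
    (a : γ → M) : Prop :=
  ∀ φ ∈ p, Formula.Realize φ (Sum.elim a Subtype.val)

/-- The tuple `a` realizes the restriction of the type `p` over `B` to the set of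
parameters `C`. -/
def RealizesTypeRestr (B : Set M) {γ : Type*} (p : Set (L.Formula (γ ⊕ ↥B)))
    (C : Set M) (a : γ → M) : Prop :=
  ∀ (k : ℕ) (ψ : L.Formula (γ ⊕ Fin k)) (c : Fin k → ↥B), (∀ i, (c i : M) ∈ C) →
    ψ.relabel (Sum.map id c) ∈ p → ψ.Realize (Sum.elim a (fun i => (c i : M)))

/-- Membership of `φ((x,y); c)` in the product `p ⊗ q` of the `A`-invariant type `p`
with the type `q`, both over `B`: for every `b` in `B` realizing the restriction of
`q` to `A ∪ c`, the formula `φ(x, b, c)` belongs to `p`. -/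
def MemProdN (B : Set M) {γ δ : Type*} (p : Set (L.Formula (γ ⊕ ↥B))) (A : Set M)
    (q : Set (L.Formula (δ ⊕ ↥B))) {k : ℕ} (φ : L.Formula ((γ ⊕ δ) ⊕ Fin k))
    (c : Fin k → ↥B) : Prop :=
  ∀ b : δ → ↥B,
    RealizesTypeRestr L B q (A ∪ Set.range (fun i => (c i : M))) (fun g => (b g : M)) →
    (φ.relabel (Sum.elim (Sum.elim Sum.inl (fun g => Sum.inr (b g)))
        (fun i => Sum.inr (c i))) ∈ p)

/-- The invariant types `p` and `q` over `B` commute: `p ⊗ q = q ⊗ p`. -/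
def CommuteN (B : Set M) {γ δ : Type*} (p : Set (L.Formula (γ ⊕ ↥B))) (A : Set M)
    (q : Set (L.Formula (δ ⊕ ↥B))) (A' : Set M) : Prop :=
  ∀ (k : ℕ) (φ : L.Formula ((γ ⊕ δ) ⊕ Fin k)) (c : Fin k → ↥B),
    MemProdN L B p A q φ c ↔ MemProdN L B q A' p (φ.relabel (Sum.map Sum.swap id)) c

/-- `p(x) ∪ q(y) ∪ {φ(x,y)}` is (finitely) satisfiable. -/
def JointlySatN (B : Set M) {γ δ : Type*} (p : Set (L.Formula (γ ⊕ ↥B)))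
    (q : Set (L.Formula (δ ⊕ ↥B))) (φ : L.Formula ((γ ⊕ δ) ⊕ ↥B)) : Prop :=
  ∀ (Sp : Set (L.Formula (γ ⊕ ↥B))) (Sq : Set (L.Formula (δ ⊕ ↥B))),
    Sp ⊆ p → Sq ⊆ q → Sp.Finite → Sq.Finite →
    ∃ (a : γ → M) (b : δ → M),
      (∀ ψ ∈ Sp, Formula.Realize ψ (Sum.elim a Subtype.val)) ∧
      (∀ ψ ∈ Sq, Formula.Realize ψ (Sum.elim b Subtype.val)) ∧
      φ.Realize (Sum.elim (Sum.elim a b) Subtype.val)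

/-- The types `p` and `q` over `B` are weakly orthogonal: `p(x) ∪ q(y)` determines a
complete type in the variables `xy`. -/
def WeaklyOrthogonalN (B : Set M) {γ δ : Type*} (p : Set (L.Formula (γ ⊕ ↥B)))
    (q : Set (L.Formula (δ ⊕ ↥B))) : Prop :=
  ∀ φ : L.Formula ((γ ⊕ δ) ⊕ ↥B),
    ¬ JointlySatN L B p q φ ∨ ¬ JointlySatN L B p q φ.not

/-- The tuple `a` realizes the canonical (invariant) extension `p | (B ∪ D)` of the
`A`-invariant type `p` over `B` to the enlarged parameter set `B ∪ D`. -/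
def RealizesInvExt (B : Set M) {γ : Type*} (p : Set (L.Formula (γ ⊕ ↥B)))
    (A : Set M) (D : Set M) (a : γ → M) : Prop :=
  ∀ (n m : ℕ) (φ : L.Formula (γ ⊕ (Fin n ⊕ Fin m))) (d : Fin n → M) (e : Fin m → ↥B),
    (∀ i, d i ∈ D) →
    (∀ d' : Fin n → ↥B,
        SameTypeOver L (A ∪ Set.range (fun i => (e i : M))) (fun i => (d' i : M)) d →
        φ.relabel (Sum.map id (Sum.elim d' e)) ∈ p) →
    φ.Realize (Sum.elim a (Sum.elim d (fun i => (e i : M))))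

end TypesOverSet

section Measures

/-- A (global) Keisler measure in the variables `γ`: a finitely additive probability
measure on the definable subsets of `M^γ` (presented as a function on formulas with
parameters in `M`, invariant under logical equivalence). -/
structure KeislerMeasure (M : Type w) [L.Structure M] (γ : Type w) where
  val : L.Formula (γ ⊕ M) → ℝ
  nonneg : ∀ φ, 0 ≤ val φ
  congr : ∀ φ ψ : L.Formula (γ ⊕ M),
    (∀ x : γ → M, φ.Realize (Sum.elim x id) ↔ ψ.Realize (Sum.elim x id)) →
    val φ = val ψ
  total : ∀ φ : L.Formula (γ ⊕ M), (∀ x : γ → M, φ.Realize (Sum.elim x id)) → val φ = 1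
  add : ∀ φ ψ χ : L.Formula (γ ⊕ M),
    (∀ x : γ → M, χ.Realize (Sum.elim x id) ↔
      (φ.Realize (Sum.elim x id) ∨ ψ.Realize (Sum.elim x id))) →
    (∀ x : γ → M, ¬ (φ.Realize (Sum.elim x id) ∧ ψ.Realize (Sum.elim x id))) →
    val χ = val φ + val ψ

variable {γ : Type w}

/-- The Keisler measure `μ` is invariant over `N`. -/
def MeasInvariantOver (μ : KeislerMeasure L M γ) (N : Set M) : Prop :=
  ∀ (k : ℕ) (b b' : Fin k → M), SameTypeOver L N b b' →
    ∀ φ : L.Formula (γ ⊕ Fin k),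
      μ.val (φ.relabel (Sum.map id b)) = μ.val (φ.relabel (Sum.map id b'))

/-- The Keisler measure `μ` is definable over `N`: for each formula `φ(x;y)` the map
`b ↦ μ(φ(x;b))` factors continuously through the type space over `N`. -/
def MeasDefinableOver (μ : KeislerMeasure L M γ) (N : Set M) : Prop :=
  ∀ (k : ℕ) (φ : L.Formula (γ ⊕ Fin k)) (ε : ℝ), 0 < ε →
    ∃ (m : ℕ) (ψ : Fin m → L.Formula (Fin k ⊕ ↥N)),
      (∀ b : Fin k → M, ∃ j, (ψ j).Realize (Sum.elim b Subtype.val)) ∧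
      ∀ (j : Fin m) (b b' : Fin k → M),
        (ψ j).Realize (Sum.elim b Subtype.val) → (ψ j).Realize (Sum.elim b' Subtype.val) →
        |μ.val (φ.relabel (Sum.map id b)) - μ.val (φ.relabel (Sum.map id b'))| ≤ ε

/-- The Keisler measure `μ` is finitely satisfiable in `N`: every formula of positive
measure is realized by a tuple from `N`. -/
def MeasFinSatIn (μ : KeislerMeasure L M γ) (N : Set M) : Prop :=
  ∀ φ : L.Formula (γ ⊕ M), 0 < μ.val φ →
    ∃ a : γ → M, (∀ g, a g ∈ N) ∧ φ.Realize (Sum.elim a id)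

/-- `μ` is generically stable over `N`: invariant over, definable over and finitely
satisfiable in `N`. -/
def MeasGenericallyStableOver (μ : KeislerMeasure L M γ) (N : Set M) : Prop :=
  MeasInvariantOver L μ N ∧ MeasDefinableOver L μ N ∧ MeasFinSatIn L μ N

/-- The measures `μ₁` and `μ₂` agree on all formulas with parameters in `B`. -/
def MeasAgreeOn (μ₁ μ₂ : KeislerMeasure L M γ) (B : Set M) : Prop :=
  ∀ (k : ℕ) (φ : L.Formula (γ ⊕ Fin k)) (c : Fin k → M), (∀ i, c i ∈ B) →
    μ₁.val (φ.relabel (Sum.map id c)) = μ₂.val (φ.relabel (Sum.map id c))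

/-- The restriction of `μ` to the model `N` is smooth: any two global measures
agreeing with `μ` on formulas over `N` agree everywhere (equivalently, `μ | N` has a
unique extension to any larger parameter set). -/
def MeasSmoothOver (μ : KeislerMeasure L M γ) (N : Set M) : Prop :=
  ∀ μ₁ μ₂ : KeislerMeasure L M γ, MeasAgreeOn L μ₁ μ N → MeasAgreeOn L μ₂ μ N →
    ∀ φ : L.Formula (γ ⊕ M), μ₁.val φ = μ₂.val φ

end Measures

section ShelahExpansion

/-- The language of the Shelah expansion `M_{[S]}`: an `n`-ary relation symbol for
every `L`-formula `φ(x₀,…,x_{n-1}; y₀,…,y_{m-1})` together with a tuple of parameters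
from `S`. -/
def extLang (S : Set M) : FirstOrder.Language :=
  ⟨fun _ => PEmpty, fun n => Σ m : ℕ, L.Formula (Fin n ⊕ Fin m) × (Fin m → ↥S)⟩

/-- The Shelah expansion structure on `↥N` induced by the trace of externally
definable sets with parameters from `S`. -/
def extStructure (N S : Set M) : (extLang L (M := M) S).Structure ↥N where
  funMap := fun f _ => PEmpty.elim f
  RelMap := fun R x => (R.2.1).Realize
    (Sum.elim (fun i => (x i : M)) (fun j => ((R.2.2 j : M))) : _ → M)

/-- A structure eliminates quantifiers: every formula is equivalent to a
quantifier-free one. -/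
def EliminatesQuantifiers (L' : FirstOrder.Language) (X : Type*) [L'.Structure X] : Prop :=
  ∀ (n : ℕ) (φ : L'.Formula (Fin n)), ∃ ψ : L'.Formula (Fin n),
    ψ.IsQF ∧ ∀ x : Fin n → X, (φ.Realize x ↔ ψ.Realize x)

end ShelahExpansion

section Definability

variable {L} {A N : Set M} {α β : Type*}

/-- Definable sets are stable under substituting variables and parameters for variables. -/
theorem definable_comap {R : Set (β → M)} (hR : A.Definable L R) (F : (α → M) → β → M)
    (hF : ∀ i, (∃ j, ∀ v, F v i = v j) ∨ ∃ a ∈ A, ∀ v, F v i = a) :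
    A.Definable L {v | F v ∈ R} := by
  classical
  obtain ⟨φ, rfl⟩ := definable_iff_exists_formula_sum.1 hR
  have hg : ∀ i, ∃ j : A ⊕ α, ∀ v, F v i = Sum.elim (↑) v j := by
    intro i
    rcases hF i with ⟨j, hj⟩ | ⟨a, ha, haF⟩
    · exact ⟨Sum.inr j, hj⟩
    · exact ⟨Sum.inl ⟨a, ha⟩, haF⟩
  choose g hg using hg
  refine definable_iff_exists_formula_sum.2 ⟨φ.relabel (Sum.elim Sum.inl g), ?_⟩
  ext v
  simp only [mem_ofPred_eq, Formula.realize_relabel]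
  rw [show (Sum.elim (↑) v ∘ Sum.elim Sum.inl g : A ⊕ β → M) = Sum.elim (↑) (F v) from ?_]
  funext i
  cases i <;> simp [hg]

theorem definable_elim_comp {ζ : Type*} {R : Set (ζ ⊕ β → M)} (hR : A.Definable L R) (f : ζ → α)
    (g : β → α) : A.Definable L {v : α → M | Sum.elim (v ∘ f) (v ∘ g) ∈ R} := by
  convert! hR.preimage_comp (Sum.elim f g) using 1
  ext v
  simp [Sum.comp_elim]

theorem definable_iff_const {p : Prop} {R : Set (α → M)} (hR : A.Definable L R) :
    A.Definable L {v | v ∈ R ↔ p} := by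
  by_cases hp : p
  · simpa [hp] using hR
  · simpa [hp] using! hR.compl

theorem definable_iff {R S : Set (α → M)} (hR : A.Definable L R) (hS : A.Definable L S) :
    A.Definable L {v | v ∈ R ↔ v ∈ S} := by
  convert! (hR.inter hS).union (hR.compl.inter hS.compl) using 1
  ext v
  simp only [mem_ofPred_eq, mem_union, mem_inter_iff, mem_compl_iff]
  tauto

theorem definable_forall_mem_finite {ι : Type*} {s : Set ι} (hs : s.Finite)
    {R : ι → Set (α → M)} (hR : ∀ i ∈ s, A.Definable L (R i)) :
    A.Definable L {v | ∀ i ∈ s, v ∈ R i} := by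
  have := hs.to_subtype
  convert! definable_iInter_of_finite (f := fun i : s => R i) fun i => hR i i.2 using 1
  ext v
  simp

/-- Every formula is a relabelling of a formula in finitely many variables. -/
theorem exists_formula_fin (φ : L.Formula α) :
    ∃ (m : ℕ) (ψ : L.Formula (Fin m)) (g : Fin m → α),
      ∀ v : α → M, φ.Realize v ↔ ψ.Realize (v ∘ g) := by
  classical
  obtain ⟨m, ⟨e⟩⟩ := Finite.exists_equiv_fin φ.freeVarFinset
  exact ⟨m, φ.restrictFreeVar e, fun i => (e.symm i).1, fun v =>
    (BoundedFormula.realize_restrictFreeVar v (by simp)).symm⟩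

/-- A definable set over an elementary set which is nonempty has a point in that set. -/
theorem IsElementarySet.exists_mem (hN : IsElementarySet L N) [Finite α] {R : Set (α → M)}
    (hR : N.Definable L R) (hne : R.Nonempty) : ∃ v ∈ R, ∀ i, v i ∈ N := by
  classical
  obtain ⟨n, ⟨e⟩⟩ := Finite.exists_equiv_fin α
  suffices H : ∀ (n : ℕ) (R : Set (Fin n → M)), N.Definable L R → R.Nonempty →
      ∃ v ∈ R, ∀ i, v i ∈ N by
    obtain ⟨v, hv, hvN⟩ := H n {v | v ∘ e ∈ R} (hR.preimage_comp e)
      (hne.imp' (fun v => v ∘ e.symm) fun v hv => by simpa [Function.comp_assoc] using hv)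
    exact ⟨v ∘ e, hv, fun i => hvN _⟩
  clear hR hne R
  intro n
  induction n with
  | zero =>
    rintro R - ⟨v, hv⟩
    exact ⟨v, hv, fun i => i.elim0⟩
  | succ n ih =>
    intro R hR ⟨v, hv⟩
    obtain ⟨a, haN, ha⟩ : ∃ a ∈ N, ∃ t : Fin n → M, (Fin.cons a t : Fin (n + 1) → M) ∈ R := by
      have hD : N.Definable L {a : Unit → M | ∃ t : Fin n → M, (Fin.cons (a ()) t : Fin (n + 1) → M) ∈ R} := by
        refine Definable.exists_of_finite (definable_comap hR
          (fun w : Unit ⊕ Fin n → M => Fin.cons (w (Sum.inl ())) (fun i => w (Sum.inr i))) ?_)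
        intro i
        left
        cases i using Fin.cases with
        | zero => exact ⟨Sum.inl (), fun v => rfl⟩
        | succ i => exact ⟨Sum.inr i, fun v => rfl⟩
      obtain ⟨φ, hφ⟩ := definable_iff_exists_formula_sum.1 hD
      obtain ⟨m, ψ, g, hψ⟩ := exists_formula_fin (M := M) φ
      obtain ⟨d, hdN, -⟩ := hN 0 ⊤ Fin.elim0 (fun i => i.elim0) ⟨v 0, by simp⟩
      have key : ∀ a : M, (fun _ : Unit => a) ∈ {a : Unit → M | ∃ t : Fin n → M,
          (Fin.cons (a ()) t : Fin (n + 1) → M) ∈ R} ↔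
          (ψ.relabel fun i => Sum.elim (fun _ => Sum.inr i) Sum.inl (g i)).Realize
            (Sum.elim (fun _ : Unit => a) fun i => Sum.elim (↑) (fun _ => d) (g i)) := by
        intro a
        rw [hφ, mem_ofPred_eq, hψ, Formula.realize_relabel]
        congr! 1
        funext i
        cases h : g i <;> simp [h]
      obtain ⟨a, haN, ha⟩ := hN m _ (fun i => Sum.elim (↑) (fun _ => d) (g i))
        (fun i => by cases h : g i <;> simp [hdN]) ⟨v 0, (key _).1 ⟨Fin.tail v, by simpa using hv⟩⟩
      exact ⟨a, haN, (key a).2 ha⟩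
    obtain ⟨t, ht, htN⟩ := ih {t | (Fin.cons a t : Fin (n + 1) → M) ∈ R}
      (definable_comap hR (fun t => Fin.cons a t) (by
        intro i
        cases i using Fin.cases with
        | zero => exact Or.inr ⟨a, haN, fun v => rfl⟩
        | succ i => exact Or.inl ⟨i, fun v => rfl⟩)) ha
    exact ⟨_, ht, fun i => by cases i using Fin.cases <;> simp [haN, htN]⟩

end Definability

section Saturation

variable {L} {N : Set M}

/-- The tuple `u` satisfies the part of the `∅`-type given by the ultrafilter `U` which
concerns the first `n` coordinates, and these coordinates lie in `N`. -/
def RealizesUpTo (L : FirstOrder.Language.{u, v}) [L.Structure M] (N : Set M)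
    (U : Ultrafilter (ℕ → M)) (n : ℕ) (u : ℕ → M) : Prop :=
  (∀ i < n, u i ∈ N) ∧ ∀ D : Set (ℕ → M), (∅ : Set M).Definable L D → D ∈ U →
    (∀ v v' : ℕ → M, (∀ i < n, v i = v' i) → v ∈ D → v' ∈ D) → u ∈ D

theorem RealizesUpTo.exists_succ
    (hsat : SetSaturatedOfCard L N (Cardinal.lift.{w} (Order.succ (cardT L))))
    {U : Ultrafilter (ℕ → M)} {n : ℕ} {u : ℕ → M} (hu : RealizesUpTo L N U n u) :
    ∃ x, RealizesUpTo L N U (n + 1) (Function.update u n x) := by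
  classical
  set C : Set M := u '' Iio n with hC
  have hCN : C ⊆ N := by
    rintro _ ⟨i, hi, rfl⟩
    exact hu.1 i hi
  have hCfin : C.Finite := (finite_Iio n).image u
  have hCcard : Cardinal.lift.{max u v} #↥C < Cardinal.lift.{w} (Order.succ (cardT L)) := by
    have h1 : Cardinal.lift.{max u v} #↥C < ℵ₀ := by
      rw [Cardinal.lift_lt_aleph0]
      exact Cardinal.lt_aleph0_iff_set_finite.2 hCfin
    have h2 : ℵ₀ ≤ Cardinal.lift.{w} (Order.succ (cardT L)) := by
      rw [Cardinal.aleph0_le_lift]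
      exact (le_max_right _ _).trans (Order.le_succ _)
    exact h1.trans_le h2
  set Dep : Set (ℕ → M) → Prop := fun D =>
    ∀ v v' : ℕ → M, (∀ i < n + 1, v i = v' i) → v ∈ D → v' ∈ D with hDep
  let p : Set (L.Formula (Unit ⊕ C)) := {φ | ∃ D : Set (ℕ → M), (∅ : Set M).Definable L D ∧
    D ∈ U ∧ Dep D ∧ ∀ x : M, φ.Realize (Sum.elim (fun _ => x) Subtype.val) ↔
      Function.update u n x ∈ D}
  obtain ⟨x, hxN, hx⟩ := hsat C hCN hCcard p (by
    intro S hS hSfin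
    choose! D hDdef hDU hDdep hD using fun φ (hφ : φ ∈ S) => hS hφ
    set E : Set (ℕ → M) := {v | ∀ φ ∈ S, v ∈ D φ} with hE
    have hEdef : (∅ : Set M).Definable L E := definable_forall_mem_finite hSfin hDdef
    have hEU : E ∈ U := by
      have : (⋂ φ ∈ S, D φ) ∈ U := (Filter.biInter_mem hSfin).2 hDU
      convert this using 1
      ext v
      simp [hE]
    have hE'def : (∅ : Set M).Definable L {v : ℕ → M | ∃ x : Unit → M,
        Function.update v n (x ()) ∈ E} := by
      refine Definable.exists_of_finite (definable_comap hEdef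
        (fun w : ℕ ⊕ Unit → M => Function.update (fun i => w (Sum.inl i)) n (w (Sum.inr ()))) ?_)
      intro i
      left
      by_cases hi : i = n
      · subst hi
        exact ⟨Sum.inr (), fun v => by simp⟩
      · exact ⟨Sum.inl i, fun v => by simp [hi]⟩
    have huE := hu.2 _ hE'def (Filter.mem_of_superset hEU fun v hv =>
        ⟨fun _ => v n, by simpa using hv⟩) (by
      rintro v v' hvv' ⟨x, hx⟩
      refine ⟨x, fun φ hφ => hDdep φ hφ _ _ ?_ (hx φ hφ)⟩
      intro i hi
      rcases Nat.lt_succ_iff_lt_or_eq.1 hi with h | h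
      · simp [Function.update_of_ne h.ne, hvv' i h]
      · subst h
        simp)
    obtain ⟨x, hx⟩ := huE
    exact ⟨x (), fun φ hφ => (hD φ hφ _).2 (hx φ hφ)⟩)
  refine ⟨x, ?_, ?_⟩
  · intro i hi
    rcases Nat.lt_succ_iff_lt_or_eq.1 hi with h | h
    · simpa [Function.update_of_ne h.ne] using hu.1 i h
    · subst h
      simpa using hxN
  · intro D hDdef hDU hDdep
    obtain ⟨φ, hφ⟩ := empty_definable_iff.1 hDdef
    have hiff : ∀ y : M, (φ.relabel (fun i : ℕ => if h : i < n then
        (Sum.inr ⟨u i, i, h, rfl⟩ : Unit ⊕ C) else Sum.inl ())).Realize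
          (Sum.elim (fun _ => y) Subtype.val) ↔ Function.update u n y ∈ D := by
      intro y
      rw [Formula.realize_relabel]
      have hag : ∀ i < n + 1, (Sum.elim (fun _ => y) Subtype.val ∘ fun i : ℕ => if h : i < n then
          (Sum.inr ⟨u i, i, h, rfl⟩ : Unit ⊕ C) else Sum.inl ()) i = Function.update u n y i := by
        intro i hi
        rcases Nat.lt_succ_iff_lt_or_eq.1 hi with h | h
        · simp [h, Function.update_of_ne h.ne]
        · subst h
          simp
      have h1 : ∀ v : ℕ → M, φ.Realize v ↔ v ∈ D := fun v => by rw [hφ]; rfl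
      rw [h1]
      exact ⟨hDdep _ _ hag, hDdep _ _ fun i hi => (hag i hi).symm⟩
    exact (hiff x).1 (hx _ ⟨D, hDdef, hDU, hDdep, hiff⟩)

/-- Countable saturation, in the form of a compactness statement for sets definable without
parameters in countably many variables. -/
theorem exists_forall_mem_of_saturated [Nonempty M]
    (hsat : SetSaturatedOfCard L N (Cardinal.lift.{w} (Order.succ (cardT L))))
    {α ι : Type*} [Countable α] (D : ι → Set (α → M))
    (hD : ∀ i, (∅ : Set M).Definable L (D i))
    (hfin : ∀ F : Finset ι, ∃ v, ∀ i ∈ F, v ∈ D i) : ∃ v, ∀ i, v ∈ D i := by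
  classical
  obtain ⟨e, he⟩ := exists_injective_nat α
  let d : M := Classical.arbitrary M
  let E : ι → Set (ℕ → M) := fun i => {w | w ∘ e ∈ D i}
  have hE : ∀ i, (∅ : Set M).Definable L (E i) := fun i => (hD i).preimage_comp e
  have hne : (Filter.generate (range E)).NeBot := by
    rw [Filter.generate_neBot_iff]
    intro t ht htfin
    choose g hg using fun T : t => ht T.2
    have := htfin.fintype
    obtain ⟨v, hv⟩ := hfin (Finset.univ.image g)
    refine ⟨Function.extend e v fun _ => d, fun T hT => ?_⟩
    rw [show T = E (g ⟨T, hT⟩) from (hg ⟨T, hT⟩).symm]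
    change Function.extend e v (fun _ => d) ∘ e ∈ D _
    rw [Function.extend_comp he]
    exact hv _ (Finset.mem_image_of_mem g (Finset.mem_univ _))
  let U := Ultrafilter.of (Filter.generate (range E))
  have hEU : ∀ i, E i ∈ U := fun i =>
    Ultrafilter.of_le _ (Filter.mem_generate_of_mem ⟨i, rfl⟩)
  have hstep : ∀ n u, ∃ x, RealizesUpTo L N U n u →
      RealizesUpTo L N U (n + 1) (Function.update u n x) := by
    intro n u
    by_cases h : RealizesUpTo L N U n u
    · exact (h.exists_succ hsat).imp fun x hx _ => hx
    · exact ⟨d, fun h' => absurd h' h⟩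
  choose f hf using hstep
  let s : ℕ → ℕ → M := fun n => Nat.rec (fun _ => d) (fun n u => Function.update u n (f n u)) n
  have hs : ∀ n, RealizesUpTo L N U n (s n) := by
    intro n
    induction n with
    | zero =>
      refine ⟨fun i hi => absurd hi (Nat.not_lt_zero i), fun D _ hDU hdep => ?_⟩
      obtain ⟨v, hv⟩ := U.nonempty_of_mem hDU
      exact hdep v _ (fun i hi => absurd hi (Nat.not_lt_zero i)) hv
    | succ n ih => exact hf n _ ih
  have hst : ∀ n i, i < n → s n i = s (i + 1) i := by
    intro n i hi
    induction n, hi using Nat.le_induction with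
    | base => rfl
    | succ n hn ih =>
      rw [← ih]
      exact Function.update_of_ne (Nat.lt_of_succ_le hn).ne _ _
  refine ⟨(fun i => s (i + 1) i) ∘ e, fun i => ?_⟩
  change (fun i => s (i + 1) i) ∈ E i
  obtain ⟨φ, hφ⟩ := empty_definable_iff.1 (hE i)
  obtain ⟨m, ψ, g, hψ⟩ := exists_formula_fin (M := M) φ
  obtain ⟨n, hn⟩ := (finite_range g).bddAbove
  have hE' : ∀ v, v ∈ E i ↔ ψ.Realize (v ∘ g) := fun v => by rw [hφ, ← hψ]; rfl
  have := (hs (n + 1)).2 (E i) (hE i) (hEU i) (by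
    intro v v' hvv'
    rw [hE', hE', show v ∘ g = v' ∘ g from funext fun j => hvv' _ (Nat.lt_succ_of_le (hn ⟨j, rfl⟩))]
    exact id)
  rw [hE'] at this ⊢
  convert this using 1
  funext j
  exact (hst _ _ (Nat.lt_succ_of_le (hn ⟨j, rfl⟩))).symm

end Saturation

section Ramsey

/-- Infinite Ramsey theorem for `k`-element subsets of `ℕ` and two colours. -/
theorem exists_strictMono_homogeneous (k : ℕ) (P : (Fin k → ℕ) → Prop) :
    ∃ s : ℕ → ℕ, StrictMono s ∧ ∀ t t' : Fin k → ℕ, StrictMono t → StrictMono t' →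
      (P (s ∘ t) ↔ P (s ∘ t')) := by
  classical
  induction k with
  | zero => exact ⟨id, strictMono_id, fun t t' _ _ => by rw [Subsingleton.elim t t']⟩
  | succ k ih =>
    have hstep : ∀ a : ℕ → ℕ, ∃ r : ℕ → ℕ, StrictMono r ∧ (∀ i, 0 < r i) ∧
        ∀ t t' : Fin k → ℕ, StrictMono t → StrictMono t' →
        (P (Fin.cons (a 0) (a ∘ r ∘ t)) ↔ P (Fin.cons (a 0) (a ∘ r ∘ t'))) := by
      intro a
      obtain ⟨s, hs, hP⟩ := ih fun t => P (Fin.cons (a 0) fun i => a (t i + 1))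
      exact ⟨fun i => s i + 1, fun i j hij => Nat.succ_lt_succ (hs hij), fun i => Nat.succ_pos _, hP⟩
    choose r hrmono hrpos hr using hstep
    let a : ℕ → ℕ → ℕ := fun n => Nat.rec id (fun _ a => a ∘ r a) n
    have ha : ∀ n, StrictMono (a n) := by
      intro n
      induction n with
      | zero => exact strictMono_id
      | succ n ih => exact ih.comp (hrmono _)
    have hrange : ∀ j i, j ≤ i → ∀ n, ∃ m, a i n = a j m := by
      intro j i hij
      induction i, hij using Nat.le_induction with
      | base => exact fun n => ⟨n, rfl⟩
      | succ i _ ih => exact fun n => ih (r (a i) n)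
    let x : ℕ → ℕ := fun n => a n 0
    have hx : StrictMono x := strictMono_nat_of_lt_succ fun n => ha n (hrpos _ _)
    let col : ℕ → Prop := fun j => P (Fin.cons (x j) (a (j + 1) ∘ Fin.val))
    have hcol : ∀ j (t : Fin k → ℕ), StrictMono t → (∀ l, j < t l) →
        (P (Fin.cons (x j) (x ∘ t)) ↔ col j) := by
      intro j t ht hjt
      choose m hm using fun l => hrange (j + 1) (t l) (hjt l) 0
      have hmm : StrictMono m := by
        intro l l' hll'
        rw [← (ha (j + 1)).lt_iff_lt, ← hm, ← hm]
        exact hx (ht hll')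
      rw [show x ∘ t = a (j + 1) ∘ m from funext hm]
      exact hr (a j) m Fin.val hmm Fin.val_strictMono
    obtain ⟨c, q, hq, hqc⟩ : ∃ (c : Prop) (q : ℕ → ℕ), StrictMono q ∧ ∀ n, (col (q n) ↔ c) := by
      by_cases h : ∃ᶠ n in Filter.atTop, col n
      · obtain ⟨q, hq, hqc⟩ := Filter.extraction_of_frequently_atTop h
        exact ⟨True, q, hq, fun n => by simp [hqc n]⟩
      · obtain ⟨q, hq, hqc⟩ := Filter.extraction_of_eventually_atTop (Filter.not_frequently.1 h)
        exact ⟨False, q, hq, fun n => by simp [hqc n]⟩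
    refine ⟨x ∘ q, hx.comp hq, ?_⟩
    have key : ∀ t : Fin (k + 1) → ℕ, StrictMono t → (P (x ∘ q ∘ t) ↔ c) := by
      intro t ht
      rw [← hqc (t 0), ← hcol (q (t 0)) (q ∘ Fin.tail t)
        (hq.comp (ht.comp Fin.strictMono_succ)) fun l => hq (ht (Fin.succ_pos l))]
      congr! 1
      funext i
      cases i using Fin.cases <;> rfl
    exact fun t t' ht ht' => (key t ht).trans (key t' ht').symm

/-- Infinite Ramsey theorem for finitely many colourings at once. -/
theorem exists_strictMono_homogeneous_finset {ι : Type*} (F : Finset ι) (k : ι → ℕ)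
    (P : ∀ i, (Fin (k i) → ℕ) → Prop) :
    ∃ s : ℕ → ℕ, StrictMono s ∧ ∀ i ∈ F, ∀ t t' : Fin (k i) → ℕ, StrictMono t → StrictMono t' →
      (P i (s ∘ t) ↔ P i (s ∘ t')) := by
  classical
  induction F using Finset.induction_on with
  | empty => exact ⟨id, strictMono_id, fun i hi => absurd hi (Finset.notMem_empty i)⟩
  | insert i F _ ih =>
    obtain ⟨s, hs, hF⟩ := ih
    obtain ⟨s', hs', hi⟩ := exists_strictMono_homogeneous (k i) fun t => P i (s ∘ t)
    refine ⟨s ∘ s', hs.comp hs', fun j hj t t' ht ht' => ?_⟩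
    rcases Finset.mem_insert.1 hj with rfl | hj
    · exact hi t t' ht ht'
    · exact hF j hj _ _ (hs'.comp ht) (hs'.comp ht')

end Ramsey

section Content

variable {N : Set M} {α : Type}

/-- A finitely additive probability measure on the definable subsets of `α → M`, definable over
`N` and finitely satisfiable in `N`, presented as a function on sets. -/
structure IsGenericallyStableContent (N : Set M) (m : Set (α → M) → ℝ) : Prop where
  nonneg : ∀ S, 0 ≤ m S
  univ_eq : m univ = 1
  union : ∀ S S', (univ : Set M).Definable L S → (univ : Set M).Definable L S' → Disjoint S S' →
    m (S ∪ S') = m S + m S'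
  definable : ∀ (ζ : Type) [Finite ζ] (R : Set (ζ ⊕ α → M)), N.Definable L R → ∀ ε > 0,
    ∃ Ψ : Set (Set (ζ → M)), Ψ.Finite ∧ (∀ D ∈ Ψ, N.Definable L D) ∧ (∀ z, ∃ D ∈ Ψ, z ∈ D) ∧
      ∀ D ∈ Ψ, ∀ z ∈ D, ∀ z' ∈ D, |m {x | Sum.elim z x ∈ R} - m {x | Sum.elim z' x ∈ R}| ≤ ε
  finSat : ∀ S, (univ : Set M).Definable L S → 0 < m S → ∃ x ∈ S, ∀ i, x i ∈ N

variable {L} {m : Set (α → M) → ℝ}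

/-- Fibres of definable sets are definable over the whole structure. -/
theorem definable_fibre {A : Set M} {ζ : Type*} {R : Set (ζ ⊕ α → M)} (hR : A.Definable L R)
    (z : ζ → M) : (univ : Set M).Definable L {x | Sum.elim z x ∈ R} :=
  definable_comap (hR.mono (subset_univ _)) (fun x => Sum.elim z x) fun i => by
    cases i with
    | inl i => exact Or.inr ⟨z i, mem_univ _, fun v => rfl⟩
    | inr i => exact Or.inl ⟨i, fun v => rfl⟩

namespace IsGenericallyStableContent

variable (hm : IsGenericallyStableContent L N m)
include hm

theorem empty_eq : m ∅ = 0 := by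
  have := hm.union ∅ ∅ definable_empty definable_empty (by simp)
  simp only [union_self] at this
  linarith

theorem inter_add_diff {S B : Set (α → M)} (hS : (univ : Set M).Definable L S)
    (hB : (univ : Set M).Definable L B) : m (B ∩ S) + m (B \ S) = m B := by
  rw [← hm.union _ _ (hB.inter hS) (hB.sdiff hS) (disjoint_sdiff_inter.symm), inter_union_sdiff]

theorem mono {S S' : Set (α → M)} (hS : (univ : Set M).Definable L S)
    (hS' : (univ : Set M).Definable L S') (h : S ⊆ S') : m S ≤ m S' := by
  rw [← hm.inter_add_diff hS hS', inter_eq_self_of_subset_right h]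
  linarith [hm.nonneg (S' \ S)]

theorem union_le {S S' : Set (α → M)} (hS : (univ : Set M).Definable L S)
    (hS' : (univ : Set M).Definable L S') : m (S ∪ S') ≤ m S + m S' := by
  rw [← hm.inter_add_diff hS (hS.union hS'), union_inter_cancel_left, union_sdiff_left]
  linarith [hm.mono (hS'.sdiff hS) hS' sdiff_subset]

theorem biUnion_le {ι : Type*} (F : Finset ι) (S : ι → Set (α → M)) {δ : ℝ}
    (hS : ∀ i ∈ F, (univ : Set M).Definable L (S i) ∧ m (S i) ≤ δ) :
    (univ : Set M).Definable L {x | ∃ i ∈ F, x ∈ S i} ∧ m {x | ∃ i ∈ F, x ∈ S i} ≤ F.card * δ := by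
  classical
  induction F using Finset.induction_on with
  | empty => simp [hm.empty_eq]
  | insert i F hi ih =>
    obtain ⟨h1, h2⟩ := ih fun j hj => hS j (Finset.mem_insert_of_mem hj)
    obtain ⟨h3, h4⟩ := hS i (Finset.mem_insert_self i F)
    have he : {x | ∃ j ∈ insert i F, x ∈ S j} = S i ∪ {x | ∃ j ∈ F, x ∈ S j} := by
      ext x
      simp
    rw [he, Finset.card_insert_of_notMem hi]
    refine ⟨h3.union h1, (hm.union_le h3 h1).trans ?_⟩
    push_cast
    linarith

/-- If every point of `B` lies in at most `r` of the sets `S i`, then the total measure of these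
sets inside `B` is at most `r` times the measure of `B`. -/
theorem sum_inter_le {ι : Type*} (F : Finset ι) (S : ι → Set (α → M))
    (hS : ∀ i, (univ : Set M).Definable L (S i)) (B : Set (α → M))
    (hB : (univ : Set M).Definable L B) (r : ℝ)
    (hr : ∀ x ∈ B, ∀ G ⊆ F, (∀ i ∈ G, x ∈ S i) → (G.card : ℝ) ≤ r) :
    ∑ i ∈ F, m (B ∩ S i) ≤ r * m B := by
  classical
  induction F using Finset.induction_on generalizing B r with
  | empty =>
    simp only [Finset.sum_empty]
    rcases B.eq_empty_or_nonempty with rfl | ⟨x, hx⟩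
    · simp [hm.empty_eq]
    · have := hr x hx ∅ (by simp) (by simp)
      exact mul_nonneg (by simpa using this) (hm.nonneg _)
  | insert i F hi ih =>
    have h1 := ih (B ∩ S i) (hB.inter (hS i)) (r - 1) (by
      intro x hx G hG hGx
      have := hr x hx.1 (insert i G) (Finset.insert_subset_insert i hG) (by
        intro j hj
        rcases Finset.mem_insert.1 hj with rfl | hj
        · exact hx.2
        · exact hGx j hj)
      rw [Finset.card_insert_of_notMem fun h => hi (hG h)] at this
      push_cast at this
      linarith)
    have h2 := ih (B \ S i) (hB.sdiff (hS i)) r (fun x hx G hG hGx =>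
      hr x hx.1 G (hG.trans (Finset.subset_insert i F)) hGx)
    have h3 : ∑ j ∈ F, m (B ∩ S j) = ∑ j ∈ F, m (B ∩ S i ∩ S j) + ∑ j ∈ F, m (B \ S i ∩ S j) := by
      rw [← Finset.sum_add_distrib]
      refine Finset.sum_congr rfl fun j _ => ?_
      rw [← hm.inter_add_diff (hS i) (hB.inter (hS j)), inter_right_comm]
      congr 2
      ext x
      simp only [mem_sdiff, mem_inter_iff]
      tauto
    rw [Finset.sum_insert hi, h3]
    have h4 := hm.inter_add_diff (hS i) hB
    rw [← h4, mul_add]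
    linarith

/-- Among sufficiently many sets of measure at least `δ`, any prescribed number have a common
point. -/
theorem exists_mem_many (S : ℕ → Set (α → M)) (hS : ∀ i, (univ : Set M).Definable L (S i))
    {δ : ℝ} (hδ : 0 < δ) (hSδ : ∀ i, δ ≤ m (S i)) (r : ℕ) :
    ∃ (x : α → M) (G : Finset ℕ), r < G.card ∧ ∀ i ∈ G, x ∈ S i := by
  by_contra! h
  obtain ⟨K, hK⟩ := exists_nat_gt ((r : ℝ) / δ)
  have h1 := hm.sum_inter_le (Finset.range K) S hS univ definable_univ r fun x _ G _ hGx => by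
    by_contra! hlt
    obtain ⟨i, hi, hxi⟩ := h x G (by exact_mod_cast hlt)
    exact hxi (hGx i hi)
  simp only [univ_inter, hm.univ_eq, mul_one] at h1
  have h2 : (Finset.range K).card • δ ≤ ∑ i ∈ Finset.range K, m (S i) :=
    Finset.card_nsmul_le_sum _ _ _ fun i _ => hSδ i
  rw [Finset.card_range, nsmul_eq_mul] at h2
  rw [div_lt_iff₀ hδ] at hK
  linarith

end IsGenericallyStableContent

end Content

section Extraction

variable {L} {N : Set M}

theorem isIndiscernibleAlongOver_empty_iff {ι γ : Type*} {r : ι → ι → Prop} {I : ι → γ → M} :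
    IsIndiscernibleAlongOver L r ∅ I ↔
      ∀ (n : ℕ) (s t : Fin n → ι), (∀ i j, i < j → r (s i) (s j)) →
        (∀ i j, i < j → r (t i) (t j)) → ∀ θ : L.Formula (Fin n × γ),
          θ.Realize (fun p => I (s p.1) p.2) ↔ θ.Realize (fun p => I (t p.1) p.2) := by
  refine ⟨fun h n s t hs ht θ => ?_, fun h n s t hs ht φ => ?_⟩
  · have := h n s t hs ht (θ.relabel Sum.inl)
    simpa only [Formula.realize_relabel, Sum.elim_comp_inl] using this
  · have := h n s t hs ht (φ.relabel (Sum.elim id fun a => (notMem_empty _ a.2).elim))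
    simp only [Formula.realize_relabel] at this
    convert this using 2 <;>
    · funext i
      rcases i with i | i
      · rfl
      · exact (notMem_empty _ i.2).elim

theorem IsIndiscernibleAlongOver.comp_right {ι γ γ' : Type*} {r : ι → ι → Prop} {I : ι → γ → M}
    (h : IsIndiscernibleAlongOver L r ∅ I) (e : γ' → γ) :
    IsIndiscernibleAlongOver L r ∅ fun i => I i ∘ e := by
  rw [isIndiscernibleAlongOver_empty_iff] at h ⊢
  intro n s t hs ht θ
  have := h n s t hs ht (θ.relabel (Prod.map id e))
  simpa only [Formula.realize_relabel] using! this

theorem IsNIP.not_alternating (hNIP : IsNIP L M) {ζ β : Type*} [Finite ζ] [Finite β]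
    {R : Set (ζ ⊕ β → M)} (hR : (∅ : Set M).Definable L R) {w : ℕ → ζ → M}
    (hw : IsIndiscernibleOver L ∅ w) (y : β → M) :
    ¬ ∀ i, (Sum.elim (w i) y ∈ R ↔ Even i) := by
  intro h
  obtain ⟨n, ⟨e⟩⟩ := Finite.exists_equiv_fin ζ
  obtain ⟨k, ⟨f⟩⟩ := Finite.exists_equiv_fin β
  obtain ⟨φ, hφ⟩ := empty_definable_iff.1 hR
  refine hNIP n k (φ.relabel (Sum.map e f)) (fun i => w i ∘ e.symm) (y ∘ f.symm)
    (hw.comp_right e.symm) fun i => ?_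
  rw [← h i, hφ, Formula.realize_relabel, mem_ofPred_eq]
  congr! 1
  funext j
  cases j <;> simp

/-- Extraction of an indiscernible sequence from an arbitrary sequence, by Ramsey and saturation,
keeping a family of properties which are finitely satisfied on subsequences. -/
theorem exists_indiscernible [Nonempty M]
    (hsat : SetSaturatedOfCard L N (Cardinal.lift.{w} (Order.succ (cardT L))))
    {ζ β ι κ : Type*} [Countable ζ] [Countable β] [Countable ι] [LinearOrder ι]
    (z : ℕ → ζ → M) (E : κ → Set ((ι × ζ) ⊕ β → M)) (hE : ∀ k, (∅ : Set M).Definable L (E k))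
    (hfin : ∀ (K : Finset κ) (F : Finset ι) (q : ℕ → ℕ), StrictMono q →
      ∃ h : ι → ℕ, StrictMonoOn h F ∧ ∃ y : β → M,
        ∀ k ∈ K, Sum.elim (fun p => z (q (h p.1)) p.2) y ∈ E k) :
    ∃ (w : ι → ζ → M) (y : β → M), IsIndiscernibleOver L ∅ w ∧
      ∀ k, Sum.elim (fun p => w p.1 p.2) y ∈ E k := by
  classical
  let Idx := Σ k : ℕ, L.Formula (Fin k × ζ) × (Fin k → ι) × (Fin k → ι)
  let D : {c : Idx // StrictMono c.2.2.1 ∧ StrictMono c.2.2.2} ⊕ κ → Set ((ι × ζ) ⊕ β → M) :=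
    Sum.elim (fun c => {v | c.1.2.1.Realize (fun p => v (Sum.inl (c.1.2.2.1 p.1, p.2))) ↔
      c.1.2.1.Realize (fun p => v (Sum.inl (c.1.2.2.2 p.1, p.2)))}) E
  have hD : ∀ i, (∅ : Set M).Definable L (D i) := by
    rintro (⟨⟨n, θ, s, t⟩, -⟩ | k)
    · have hθ : (∅ : Set M).Definable L {v : Fin n × ζ → M | θ.Realize v} :=
        empty_definable_iff.2 ⟨θ, rfl⟩
      exact definable_iff (hθ.preimage_comp fun p : Fin n × ζ => Sum.inl (s p.1, p.2))
        (hθ.preimage_comp fun p : Fin n × ζ => Sum.inl (t p.1, p.2))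
    · exact hE k
  obtain ⟨v, hv⟩ := exists_forall_mem_of_saturated hsat D hD (by
    intro G
    obtain ⟨q, hq, hqP⟩ := exists_strictMono_homogeneous_finset G.toLeft (fun c => c.1.1)
      fun c t => c.1.2.1.Realize fun p => z (t p.1) p.2
    obtain ⟨h, hh, y, hy⟩ := hfin G.toRight (G.toLeft.biUnion fun c =>
      Finset.univ.image c.1.2.2.1 ∪ Finset.univ.image c.1.2.2.2) q hq
    refine ⟨Sum.elim (fun p : ι × ζ => z (q (h p.1)) p.2) y, fun i hi => ?_⟩
    rcases i with c | k
    · have hmem : ∀ l, c.1.2.2.1 l ∈ (G.toLeft.biUnion fun c =>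
          Finset.univ.image c.1.2.2.1 ∪ Finset.univ.image c.1.2.2.2) ∧
          c.1.2.2.2 l ∈ (G.toLeft.biUnion fun c =>
          Finset.univ.image c.1.2.2.1 ∪ Finset.univ.image c.1.2.2.2) := by
        intro l
        simp only [Finset.mem_biUnion, Finset.mem_union, Finset.mem_image, Finset.mem_univ,
          true_and]
        exact ⟨⟨c, Finset.mem_toLeft.2 hi, Or.inl ⟨l, rfl⟩⟩,
          ⟨c, Finset.mem_toLeft.2 hi, Or.inr ⟨l, rfl⟩⟩⟩
      exact hqP c (Finset.mem_toLeft.2 hi) (h ∘ c.1.2.2.1) (h ∘ c.1.2.2.2)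
        (fun i j hij => hh (hmem i).1 (hmem j).1 (c.2.1 hij))
        (fun i j hij => hh (hmem i).2 (hmem j).2 (c.2.2 hij))
    · exact hy k (Finset.mem_toRight.2 hi))
  refine ⟨fun i j => v (Sum.inl (i, j)), fun j => v (Sum.inr j), ?_, fun k => ?_⟩
  · refine isIndiscernibleAlongOver_empty_iff.2 fun n s t hs ht θ => ?_
    exact hv (Sum.inl ⟨⟨n, θ, s, t⟩, fun i j => hs i j, fun i j => ht i j⟩)
  · convert! hv (Sum.inr k) using 1
    funext i
    rcases i with i | i <;> rfl

end Extraction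

section TotallyBounded

variable {L} {N : Set M} {α ζ : Type} {m : Set (α → M) → ℝ}

/-- The fibres of a definable relation at points of `N` form a totally bounded family with respect
to the pseudometric `m (S ∆ S')`, by NIP. -/
theorem IsGenericallyStableContent.exists_net [Nonempty M] [Finite α] [Finite ζ]
    (hm : IsGenericallyStableContent L N m) (hNIP : IsNIP L M)
    (hsat : SetSaturatedOfCard L N (Cardinal.lift.{w} (Order.succ (cardT L))))
    {R : Set (ζ ⊕ α → M)} (hR : (∅ : Set M).Definable L R) {δ : ℝ} (hδ : 0 < δ) :
    ∃ C : Finset (ζ → M), (∀ c ∈ C, ∀ i, c i ∈ N) ∧ ∀ z : ζ → M, (∀ i, z i ∈ N) →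
      ∃ c ∈ C, m {x | ¬ (Sum.elim z x ∈ R ↔ Sum.elim c x ∈ R)} ≤ δ := by
  classical
  by_contra hcon
  obtain ⟨z, -, hz⟩ := exists_seq_of_forall_finset_exists (fun z : ζ → M => ∀ i, z i ∈ N)
    (fun c z => δ < m {x | ¬ (Sum.elim z x ∈ R ↔ Sum.elim c x ∈ R)}) fun C hC => by
      by_contra h
      refine hcon ⟨C, hC, fun z hz => ?_⟩
      by_contra h'
      exact h ⟨z, hz, fun c hc => not_le.1 fun hle => h' ⟨c, hc, hle⟩⟩
  obtain ⟨w, y, hw, hy⟩ := exists_indiscernible (β := α) (ι := ℕ) (κ := ℕ) hsat z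
    (fun i => {v | Sum.elim (v ∘ fun j => Sum.inl (i, j)) (v ∘ Sum.inr) ∈ R ↔ Even i})
    (fun i => definable_iff_const (definable_elim_comp hR _ _)) (by
    intro K F q hq
    obtain ⟨n, hn⟩ := (K ∪ F).bddAbove
    have hKn : ∀ i ∈ K, i < n + 1 := fun i hi =>
      Nat.lt_succ_of_le (hn (Finset.mem_coe.2 (Finset.mem_union_left F hi)))
    have hFn : ∀ i ∈ F, i < n + 1 := fun i hi =>
      Nat.lt_succ_of_le (hn (Finset.mem_coe.2 (Finset.mem_union_right K hi)))
    obtain ⟨x, G, hG, hxG⟩ := hm.exists_mem_many (fun i =>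
        {x | ¬ (Sum.elim (z (q (2 * i + 1))) x ∈ R ↔ Sum.elim (z (q (2 * i))) x ∈ R)})
      (fun i => (definable_iff (definable_fibre hR _) (definable_fibre hR _)).compl) hδ
      (fun i => (hz _ _ (hq (Nat.lt_succ_self _))).le) (n + 1)
    let g : Fin (n + 1) → ℕ := fun l => G.orderEmbOfFin rfl (Fin.castLE hG.le l)
    have hg : StrictMono g := fun i j hij => (G.orderEmbOfFin rfl).strictMono (by simpa using hij)
    have hgG : ∀ l, g l ∈ G := fun l => G.orderEmbOfFin_mem rfl _
    let h : ℕ → ℕ := fun l => if hl : l < n + 1 then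
      (if Sum.elim (z (q (2 * g ⟨l, hl⟩))) x ∈ R ↔ Even l then 2 * g ⟨l, hl⟩
        else 2 * g ⟨l, hl⟩ + 1) else 0
    refine ⟨h, ?_, x, ?_⟩
    · intro i hi j hj hij
      have := hg (show (⟨i, hFn i hi⟩ : Fin (n + 1)) < ⟨j, hFn j hj⟩ from hij)
      simp only [h, hFn i hi, hFn j hj, dif_pos]
      split_ifs <;> omega
    · intro i hi
      have h1 := hxG _ (hgG ⟨i, hKn i hi⟩)
      have h2 : Sum.elim (z (q (h i))) x ∈ R ↔ Even i := by
        simp only [h, hKn i hi, dif_pos]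
        simp only [mem_ofPred_eq] at h1
        split_ifs with h3
        · exact h3
        · tauto
      exact h2)
  exact hNIP.not_alternating hR hw y hy

/-- Up to small measure, the fibre of a definable relation at a point only depends on finitely many
definable conditions on that point. -/
theorem IsGenericallyStableContent.exists_finite_of_empty_definable [Nonempty M] [Finite α]
    [Finite ζ] (hm : IsGenericallyStableContent L N m) (hNIP : IsNIP L M)
    (hN : IsElementarySet L N)
    (hsat : SetSaturatedOfCard L N (Cardinal.lift.{w} (Order.succ (cardT L))))
    {R : Set (ζ ⊕ α → M)} (hR : (∅ : Set M).Definable L R) {δ : ℝ} (hδ : 0 < δ) :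
    ∃ Ψ : Set (Set (ζ → M)), Ψ.Finite ∧ (∀ D ∈ Ψ, N.Definable L D) ∧
      ∀ z z' : ζ → M, (∀ D ∈ Ψ, z ∈ D ↔ z' ∈ D) →
        m {x | ¬ (Sum.elim z x ∈ R ↔ Sum.elim z' x ∈ R)} ≤ δ := by
  obtain ⟨C, hCN, hC⟩ := hm.exists_net hNIP hsat hR (show 0 < δ / 4 by linarith)
  obtain ⟨Ψ, hΨfin, hΨdef, hΨcov, hΨ⟩ := hm.definable (ζ ⊕ ζ)
    {v | ¬ (Sum.elim (v ∘ Sum.inl ∘ Sum.inl) (v ∘ Sum.inr) ∈ R ↔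
      Sum.elim (v ∘ Sum.inl ∘ Sum.inr) (v ∘ Sum.inr) ∈ R)}
    (definable_iff ((definable_elim_comp hR _ _).mono (empty_subset N))
      ((definable_elim_comp hR _ _).mono (empty_subset N))).compl (δ / 4) (by linarith)
  let Θ : Set (Set (ζ → M)) := image2 (fun D c => {z | Sum.elim z c ∈ D}) Ψ C
  have hΘfin : Θ.Finite := hΨfin.image2 _ C.finite_toSet
  have hΘdef : ∀ D ∈ Θ, N.Definable L D := by
    rintro _ ⟨D, hD, c, hc, rfl⟩
    refine definable_comap (hΨdef D hD) (fun z => Sum.elim z c) fun i => ?_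
    rcases i with i | i
    · exact Or.inl ⟨i, fun v => rfl⟩
    · exact Or.inr ⟨c i, hCN c hc i, fun v => rfl⟩
  refine ⟨Θ, hΘfin, hΘdef, fun z z' hzz' => ?_⟩
  obtain ⟨w, hw, hwN⟩ := hN.exists_mem
    (definable_forall_mem_finite hΘfin fun D hD =>
      definable_iff_const (p := z ∈ D) (hΘdef D hD)) ⟨z, fun D _ => Iff.rfl⟩
  obtain ⟨c, hc, hwc⟩ := hC w hwN
  obtain ⟨D, hD, hwD⟩ := hΨcov (Sum.elim w c)
  have hzD : Sum.elim z c ∈ D := (hw _ ⟨D, hD, c, hc, rfl⟩).1 hwD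
  have hzD' : Sum.elim z' c ∈ D := (hzz' _ ⟨D, hD, c, hc, rfl⟩).1 hzD
  have hdist : ∀ z, Sum.elim z c ∈ D → m {x | ¬ (Sum.elim z x ∈ R ↔ Sum.elim c x ∈ R)} ≤ δ / 2 := by
    intro z hz
    have h1 := (abs_le.1 (hΨ D hD _ hz _ hwD)).2
    change m {x | ¬ (Sum.elim z x ∈ R ↔ Sum.elim c x ∈ R)} -
      m {x | ¬ (Sum.elim w x ∈ R ↔ Sum.elim c x ∈ R)} ≤ δ / 4 at h1
    linarith
  have hdef : ∀ z z' : ζ → M, (univ : Set M).Definable L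
      {x | ¬ (Sum.elim z x ∈ R ↔ Sum.elim z' x ∈ R)} := fun z z' =>
    (definable_iff (definable_fibre hR z) (definable_fibre hR z')).compl
  calc m {x | ¬ (Sum.elim z x ∈ R ↔ Sum.elim z' x ∈ R)}
      ≤ m ({x | ¬ (Sum.elim z x ∈ R ↔ Sum.elim c x ∈ R)} ∪
          {x | ¬ (Sum.elim z' x ∈ R ↔ Sum.elim c x ∈ R)}) := by
        refine hm.mono (hdef _ _) ((hdef _ _).union (hdef _ _)) fun x hx => ?_
        simp only [mem_ofPred_eq, mem_union] at hx ⊢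
        tauto
    _ ≤ _ := hm.union_le (hdef _ _) (hdef _ _)
    _ ≤ δ := by linarith [hdist z hzD, hdist z' hzD']

/-- A definable set over `N` is the fibre over a tuple of `N` of a set definable without
parameters. -/
theorem exists_fibre_of_definable {β : Type*} {R : Set (β → M)} (hR : N.Definable L R) :
    ∃ (k : ℕ) (d : Fin k → M) (R' : Set (Fin k ⊕ β → M)), (∀ i, d i ∈ N) ∧
      (∅ : Set M).Definable L R' ∧ ∀ v, v ∈ R ↔ Sum.elim d v ∈ R' := by
  obtain ⟨A, hAN, hA⟩ := definable_iff_finitely_definable.1 hR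
  obtain ⟨φ, rfl⟩ := definable_iff_exists_formula_sum.1 hA
  obtain ⟨k, ⟨e⟩⟩ := Finite.exists_equiv_fin A
  refine ⟨k, fun i => (e.symm i).1, {v | (φ.relabel (Sum.map e id)).Realize v},
    fun i => hAN (e.symm i).2, empty_definable_iff.2 ⟨_, rfl⟩, fun v => ?_⟩
  rw [mem_ofPred_eq, mem_ofPred_eq, Formula.realize_relabel]
  congr! 1
  funext i
  rcases i with i | i
  · simp
  · rfl

theorem IsGenericallyStableContent.exists_finite [Nonempty M] [Finite α]
    [Finite ζ] (hm : IsGenericallyStableContent L N m) (hNIP : IsNIP L M)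
    (hN : IsElementarySet L N)
    (hsat : SetSaturatedOfCard L N (Cardinal.lift.{w} (Order.succ (cardT L))))
    {R : Set (ζ ⊕ α → M)} (hR : N.Definable L R) {δ : ℝ} (hδ : 0 < δ) :
    ∃ Ψ : Set (Set (ζ → M)), Ψ.Finite ∧ (∀ D ∈ Ψ, N.Definable L D) ∧
      ∀ z z' : ζ → M, (∀ D ∈ Ψ, z ∈ D ↔ z' ∈ D) →
        m {x | ¬ (Sum.elim z x ∈ R ↔ Sum.elim z' x ∈ R)} ≤ δ := by
  obtain ⟨k, d, R', hdN, hR', hRR'⟩ := exists_fibre_of_definable hR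
  obtain ⟨Ψ, hΨfin, hΨdef, hΨ⟩ := hm.exists_finite_of_empty_definable hNIP hN hsat
    (R := {v : (Fin k ⊕ ζ) ⊕ α → M | Sum.elim (v ∘ Sum.inl ∘ Sum.inl)
      (v ∘ Sum.map Sum.inr id) ∈ R'}) (definable_elim_comp hR' _ _) hδ
  refine ⟨(fun D => {z | Sum.elim d z ∈ D}) '' Ψ, hΨfin.image _, ?_, fun z z' h => ?_⟩
  · rintro _ ⟨D, hD, rfl⟩
    refine definable_comap (hΨdef D hD) (fun z => Sum.elim d z) fun i => ?_
    rcases i with i | i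
    · exact Or.inr ⟨d i, hdN i, fun v => rfl⟩
    · exact Or.inl ⟨i, fun v => rfl⟩
  · have := hΨ (Sum.elim d z) (Sum.elim d z') fun D hD => h _ ⟨D, hD, rfl⟩
    convert this using 3
    ext x
    simp only [hRR', mem_ofPred_eq]
    have he : ∀ z : ζ → M, (Sum.elim (Sum.elim d z) x : (Fin k ⊕ ζ) ⊕ α → M) ∘ Sum.map Sum.inr id =
        Sum.elim z x := by
      intro z
      funext i
      rcases i with i | i <;> rfl
    simp only [he]
    rfl

end TotallyBounded

section Approximation

variable {L} {N : Set M} {α β : Type}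

/-- A finite sequence of tuples together with one more tuple, as a single tuple. -/
def joint {ι α β : Type*} (a : ι → α → M) (y : β → M) : (ι × α) ⊕ β → M :=
  Sum.elim (fun p => a p.1 p.2) y

theorem joint_snoc {T : ℕ} (a : Fin T → α → M) (x : α → M) (y : β → M) :
    joint (Fin.snoc a x : Fin (T + 1) → α → M) y = Sum.elim (joint a y) x ∘
      Sum.elim (fun p : Fin (T + 1) × α => Fin.lastCases (motive := fun _ => ((Fin T × α) ⊕ β) ⊕ α)
        (Sum.inr p.2) (fun t => Sum.inl (Sum.inl (t, p.2))) p.1) (Sum.inl ∘ Sum.inr) := by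
  funext i
  rcases i with ⟨t, i⟩ | i
  · cases t using Fin.lastCases <;> simp [joint]
  · rfl

/-- The relation `R`, with its last tuple of the sequence separated from the other variables. -/
theorem definable_snoc {A : Set M} {T : ℕ} {R : Set ((Fin (T + 1) × α) ⊕ β → M)}
    (hR : A.Definable L R) : ∃ R' : Set (((Fin T × α) ⊕ β) ⊕ α → M), A.Definable L R' ∧
      ∀ (a : Fin T → α → M) (x : α → M) (y : β → M),
        joint (Fin.snoc a x : Fin (T + 1) → α → M) y ∈ R ↔ Sum.elim (joint a y) x ∈ R' :=
  ⟨_, hR.preimage_comp _, fun a x y => by rw [joint_snoc]; rfl⟩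

theorem IsGenericallyStableContent.exists_sequence [Nonempty M] [Finite α] [Finite β]
    {m : Set (α → M) → ℝ} (hm : IsGenericallyStableContent L N m) (hNIP : IsNIP L M)
    (hN : IsElementarySet L N)
    (hsat : SetSaturatedOfCard L N (Cardinal.lift.{w} (Order.succ (cardT L))))
    {P : Set (α ⊕ β → M)} (hP : (∅ : Set M).Definable L P) (b : β → M) {ε : ℝ} (hε : 0 < ε)
    (hb : ∀ ρ : Set (β → M), N.Definable L ρ → b ∈ ρ →
      ε ≤ m {x | Sum.elim x b ∈ P ∧ ∃ y, y ∈ ρ ∧ Sum.elim x y ∉ P})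
    (c : α → M) (hc : ∀ i, c i ∈ N) (T : ℕ) (Γ : Set (Set ((Fin T × α) ⊕ β → M)))
    (hΓ : Γ.Finite) (hΓdef : ∀ R ∈ Γ, N.Definable L R) :
    ∃ (a : Fin T → α → M) (y : Fin T → β → M), (∀ t i, a t i ∈ N) ∧
      (∀ t, Sum.elim (a t) b ∈ P ∧ Sum.elim (a t) (y t) ∉ P) ∧
      ∀ R ∈ Γ, ∀ t, (joint (Function.update a t c) (y t) ∈ R ↔
        joint (Function.update a t c) b ∈ R) := by
  classical
  induction T with
  | zero => exact ⟨Fin.elim0, Fin.elim0, fun t => t.elim0, fun t => t.elim0, fun R _ t => t.elim0⟩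
  | succ T ih =>
    choose! R' hR'def hR' using fun R hR => definable_snoc (hΓdef R hR)
    let K : Finset (Fin T × Set ((Fin (T + 1) × α) ⊕ β → M)) := Finset.univ ×ˢ hΓ.toFinset
    have hδ : 0 < ε / (K.card + 1) := by positivity
    choose! Ψ hΨfin hΨdef hΨ using fun R hR =>
      hm.exists_finite hNIP hN hsat (hR'def R hR) hδ
    obtain ⟨a, y, haN, hay, ha⟩ := ih (⋃ R ∈ Γ, Ψ R) (hΓ.biUnion hΨfin) (by
      intro D hD
      obtain ⟨R, hR, hD⟩ := mem_iUnion₂.1 hD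
      exact hΨdef R hR D hD)
    let bad : Fin T × Set ((Fin (T + 1) × α) ⊕ β → M) → Set (α → M) := fun p =>
      {x | ¬ (Sum.elim (joint (Function.update a p.1 c) (y p.1)) x ∈ R' p.2 ↔
        Sum.elim (joint (Function.update a p.1 c) b) x ∈ R' p.2)}
    obtain ⟨hbaddef, hbad⟩ := hm.biUnion_le K bad (δ := ε / (K.card + 1)) (by
      rintro ⟨t, R⟩ hp
      have hR : R ∈ Γ := by simpa [K] using hp
      refine ⟨(definable_iff (definable_fibre (hR'def R hR) _)
        (definable_fibre (hR'def R hR) _)).compl, hΨ R hR _ _ fun D hD => ?_⟩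
      exact ha D (mem_iUnion₂.2 ⟨R, hR, hD⟩) t)
    set bads := {x | ∃ p ∈ K, x ∈ bad p} with hbads
    let ρ : Set (β → M) := {z | ∀ R ∈ Γ, joint (Fin.snoc a c : Fin (T + 1) → α → M) z ∈ R ↔
      joint (Fin.snoc a c : Fin (T + 1) → α → M) b ∈ R}
    have hρdef : N.Definable L ρ := by
      refine definable_forall_mem_finite hΓ fun R hR => definable_iff_const
        (R := {z : β → M | joint (Fin.snoc a c : Fin (T + 1) → α → M) z ∈ R})
        (definable_comap (hΓdef R hR) (fun z => joint (Fin.snoc a c : Fin (T + 1) → α → M) z) ?_)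
      rintro (⟨t, i⟩ | j)
      · refine Or.inr ⟨(Fin.snoc a c : Fin (T + 1) → α → M) t i, ?_, fun v => rfl⟩
        cases t using Fin.lastCases with
        | last => simpa using hc i
        | cast t => simpa using haN t i
      · exact Or.inl ⟨j, fun v => rfl⟩
    set S := {x | Sum.elim x b ∈ P ∧ ∃ z, z ∈ ρ ∧ Sum.elim x z ∉ P} with hS
    have hSdef : (univ : Set M).Definable L S := by
      have h1 : (univ : Set M).Definable L {x : α → M | Sum.elim x b ∈ P} := by
        refine definable_comap (hP.mono (empty_subset _)) (fun x => Sum.elim x b) ?_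
        rintro (i | i)
        · exact Or.inl ⟨i, fun v => rfl⟩
        · exact Or.inr ⟨b i, mem_univ _, fun v => rfl⟩
      refine h1.inter (Definable.exists_of_finite (S := {v : α ⊕ β → M | v ∘ Sum.inr ∈ ρ ∧ v ∉ P})
        (((hρdef.preimage_comp _).mono (subset_univ _)).inter (hP.mono (empty_subset _)).compl))
    have hSpos : 0 < m (S \ bads) := by
      have h1 := hm.mono hSdef (hbaddef.union (hSdef.sdiff hbaddef)) (by
        intro x hx
        by_cases h : x ∈ bads
        · exact Or.inl h
        · exact Or.inr ⟨hx, h⟩)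
      have h2 := hm.union_le hbaddef (hSdef.sdiff hbaddef)
      have h3 := hb ρ hρdef fun R _ => Iff.rfl
      have h4 : K.card * (ε / (K.card + 1)) < ε := by
        rw [mul_div_assoc', div_lt_iff₀ (by positivity)]
        nlinarith
      linarith
    obtain ⟨x, ⟨⟨hxb, z, hzρ, hxz⟩, hxbad⟩, hxN⟩ := hm.finSat _ (hSdef.sdiff hbaddef) hSpos
    refine ⟨Fin.snoc a x, Fin.snoc y z, ?_, ?_, ?_⟩
    · intro t i
      cases t using Fin.lastCases <;> simp [haN, hxN]
    · intro t
      cases t using Fin.lastCases <;> simp [hxb, hxz, hay]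
    · intro R hR t
      cases t using Fin.lastCases with
      | last =>
        have := hzρ R hR
        simpa [Fin.update_snoc_last] using this
      | cast t =>
        simp only [← Fin.snoc_update, Fin.snoc_castSucc, hR' R hR]
        by_contra h
        exact hxbad ⟨(t, R), by simpa [K] using hR, h⟩

end Approximation

section Exchange

variable {L} {N : Set M} {α β : Type}

theorem IsGenericallyStableContent.exists_exchange_finite [Nonempty M] [Finite α] [Finite β]
    {m : Set (α → M) → ℝ} (hm : IsGenericallyStableContent L N m) (hNIP : IsNIP L M)
    (hN : IsElementarySet L N)
    (hsat : SetSaturatedOfCard L N (Cardinal.lift.{w} (Order.succ (cardT L))))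
    {P : Set (α ⊕ β → M)} (hP : (∅ : Set M).Definable L P) (b : β → M) {ε : ℝ} (hε : 0 < ε)
    (hb : ∀ ρ : Set (β → M), N.Definable L ρ → b ∈ ρ →
      ε ≤ m {x | Sum.elim x b ∈ P ∧ ∃ y, y ∈ ρ ∧ Sum.elim x y ∉ P})
    (T : ℕ) (Θ : Set (Set (Fin T × α → M))) (hΘ : Θ.Finite)
    (hΘdef : ∀ θ ∈ Θ, (∅ : Set M).Definable L θ) :
    ∃ a e : Fin T → α → M, ∀ t, Sum.elim (a t) b ∈ P ∧ Sum.elim (e t) b ∉ P ∧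
      ∀ θ ∈ Θ, ((fun p : Fin T × α => Function.update a t (e t) p.1 p.2) ∈ θ ↔
        (fun p : Fin T × α => a p.1 p.2) ∈ θ) := by
  classical
  let d : M := Classical.arbitrary M
  obtain ⟨c, -, hc⟩ := hN.exists_mem (R := (univ : Set (α → M))) definable_univ ⟨fun _ => d, trivial⟩
  let R : Fin T → Set (Set (Fin T × α → M)) → Set ((Fin T × α) ⊕ β → M) := fun t v =>
    {w | ∃ x : α → M, Sum.elim x (w ∘ Sum.inr) ∉ P ∧
      ∀ θ ∈ Θ, (fun p : Fin T × α => if p.1 = t then x p.2 else w (Sum.inl p)) ∈ θ ↔ θ ∈ v}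
  have hRdef : ∀ t v, (∅ : Set M).Definable L (R t v) := by
    intro t v
    refine Definable.exists_of_finite (S := {u : ((Fin T × α) ⊕ β) ⊕ α → M |
      Sum.elim (u ∘ Sum.inr) (u ∘ Sum.inl ∘ Sum.inr) ∉ P ∧ ∀ θ ∈ Θ, (fun p : Fin T × α =>
        if p.1 = t then u (Sum.inr p.2) else u (Sum.inl (Sum.inl p))) ∈ θ ↔ θ ∈ v}) ?_
    refine (definable_elim_comp hP _ _).compl.inter
      (definable_forall_mem_finite hΘ fun θ hθ => definable_iff_const
        (R := {u : ((Fin T × α) ⊕ β) ⊕ α → M | (fun p : Fin T × α =>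
          if p.1 = t then u (Sum.inr p.2) else u (Sum.inl (Sum.inl p))) ∈ θ})
        (definable_comap (hΘdef θ hθ) _ fun p => Or.inl ?_))
    by_cases hp : p.1 = t
    · exact ⟨Sum.inr p.2, fun v => by simp [hp]⟩
    · exact ⟨Sum.inl (Sum.inl p), fun v => by simp [hp]⟩
  obtain ⟨a, y, -, hay, ha⟩ := hm.exists_sequence hNIP hN hsat hP b hε hb c hc T
    (image2 R univ {v | v ⊆ Θ}) (finite_univ.image2 _ hΘ.finite_subsets) (by
      rintro _ ⟨t, -, v, -, rfl⟩
      exact (hRdef t v).mono (empty_subset N))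
  have hex : ∀ t, joint (Function.update a t c) b ∈
      R t {θ ∈ Θ | (fun p : Fin T × α => a p.1 p.2) ∈ θ} := by
    intro t
    rw [← ha _ ⟨t, mem_univ t, _, sep_subset _ _, rfl⟩ t]
    refine ⟨a t, (hay t).2, fun θ hθ => ?_⟩
    have : (fun p : Fin T × α => if p.1 = t then a t p.2 else
        joint (Function.update a t c) (y t) (Sum.inl p)) = fun p => a p.1 p.2 := by
      funext p
      by_cases hp : p.1 = t
      · simp [hp]
      · simp [hp, joint]
    rw [this]
    exact ⟨fun h => ⟨hθ, h⟩, fun h => h.2⟩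
  choose e he1 he2 using hex
  refine ⟨a, e, fun t => ⟨(hay t).1, he1 t, fun θ hθ => ?_⟩⟩
  have h := he2 t θ hθ
  have h' : (fun p : Fin T × α => if p.1 = t then e t p.2 else
      joint (Function.update a t c) b (Sum.inl p)) =
      fun p => Function.update a t (e t) p.1 p.2 := by
    funext p
    by_cases hp : p.1 = t
    · rw [if_pos hp, hp, Function.update_self]
    · simp [hp, joint]
  rw [h'] at h
  exact h.trans ⟨fun h => h.2, fun h => ⟨hθ, h⟩⟩

/-- A formula in `k` tuples of variables, an increasing sequence of `k` indices, and one of its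
positions. -/
abbrev ExchangeIndex (L : FirstOrder.Language.{u, v}) (α : Type) (ι : Type*) [LinearOrder ι] :=
  {c : Σ k : ℕ, L.Formula (Fin k × α) × (Fin k → ι) × Fin k // StrictMono c.2.2.1}

/-- Conditions on a sequence of pairs of tuples `(a i, e i)` and a tuple `y` expressing that any
`a i` can be replaced by `e i` in any formula in an increasing finite subsequence of `a`, while `P`
holds of `(a i, y)` and fails for `(e i, y)`. -/
def exchangeSet (P : Set (α ⊕ β → M)) {ι : Type*} [LinearOrder ι] :
    ExchangeIndex L α ι ⊕ ι →
      Set ((ι × (α ⊕ α)) ⊕ β → M) :=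
  Sum.elim
    (fun c => {v |
      c.1.2.1.Realize (fun p => v (Sum.inl (c.1.2.2.1 p.1,
        if p.1 = c.1.2.2.2 then Sum.inr p.2 else Sum.inl p.2))) ↔
      c.1.2.1.Realize (fun p => v (Sum.inl (c.1.2.2.1 p.1, Sum.inl p.2)))})
    (fun i => {v | Sum.elim (v ∘ fun j => Sum.inl (i, Sum.inl j)) (v ∘ Sum.inr) ∈ P ∧
      Sum.elim (v ∘ fun j => Sum.inl (i, Sum.inr j)) (v ∘ Sum.inr) ∉ P})

theorem definable_exchangeSet {P : Set (α ⊕ β → M)} (hP : (∅ : Set M).Definable L P) {ι : Type*}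
    [LinearOrder ι]
    (c : ExchangeIndex L α ι ⊕ ι) :
    (∅ : Set M).Definable L (exchangeSet P c) := by
  rcases c with ⟨⟨k, θ, s, i⟩, -⟩ | i
  · have hθ : (∅ : Set M).Definable L {v : Fin k × α → M | θ.Realize v} :=
      empty_definable_iff.2 ⟨θ, rfl⟩
    exact definable_iff (hθ.preimage_comp fun p : Fin k × α => Sum.inl (s p.1,
        if p.1 = i then Sum.inr p.2 else Sum.inl p.2))
      (hθ.preimage_comp fun p : Fin k × α => Sum.inl (s p.1, Sum.inl p.2))
  · exact (definable_elim_comp hP _ _).inter (definable_elim_comp hP _ _).compl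

theorem IsGenericallyStableContent.exists_exchange [Nonempty M] [Finite α] [Finite β]
    {m : Set (α → M) → ℝ} (hm : IsGenericallyStableContent L N m) (hNIP : IsNIP L M)
    (hN : IsElementarySet L N)
    (hsat : SetSaturatedOfCard L N (Cardinal.lift.{w} (Order.succ (cardT L))))
    {P : Set (α ⊕ β → M)} (hP : (∅ : Set M).Definable L P) (b : β → M) {ε : ℝ} (hε : 0 < ε)
    (hb : ∀ ρ : Set (β → M), N.Definable L ρ → b ∈ ρ →
      ε ≤ m {x | Sum.elim x b ∈ P ∧ ∃ y, y ∈ ρ ∧ Sum.elim x y ∉ P}) :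
    ∃ v : (ℕ × (α ⊕ α)) ⊕ β → M, ∀ c, v ∈ exchangeSet (L := L) P c := by
  classical
  refine exists_forall_mem_of_saturated hsat (exchangeSet P) (definable_exchangeSet hP) ?_
  intro G
  obtain ⟨T, hT⟩ := (G.toLeft.biUnion (fun c => Finset.univ.image c.1.2.2.1) ∪ G.toRight).bddAbove
  have hTs : ∀ c, Sum.inl c ∈ G → ∀ l, c.1.2.2.1 l < T + 1 := by
    intro c hc l
    refine Nat.lt_succ_of_le (hT (Finset.mem_coe.2 (Finset.mem_union_left _ ?_)))
    exact Finset.mem_biUnion.2 ⟨c, Finset.mem_toLeft.2 hc,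
      Finset.mem_image_of_mem _ (Finset.mem_univ l)⟩
  obtain ⟨a, e, hae⟩ := hm.exists_exchange_finite hNIP hN hsat hP b hε hb (T + 1)
    ((fun c : ExchangeIndex L α ℕ => {w | c.1.2.1.Realize fun p => w (Fin.ofNat (T + 1) (c.1.2.2.1 p.1), p.2)}) ''
      (G.toLeft : Set _)) (G.toLeft.finite_toSet.image _) (by
      rintro _ ⟨c, -, rfl⟩
      have hθ : (∅ : Set M).Definable L {v : Fin c.1.1 × α → M | c.1.2.1.Realize v} :=
        empty_definable_iff.2 ⟨_, rfl⟩
      exact hθ.preimage_comp fun p => (Fin.ofNat (T + 1) (c.1.2.2.1 p.1), p.2))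
  refine ⟨joint (fun i => Sum.elim (a (Fin.ofNat (T + 1) i)) (e (Fin.ofNat (T + 1) i))) b, ?_⟩
  rintro (c | i) hc
  · have h := (hae (Fin.ofNat (T + 1) (c.1.2.2.1 c.1.2.2.2))).2.2 _
      ⟨c, Finset.mem_coe.2 (Finset.mem_toLeft.2 hc), rfl⟩
    simp only [mem_ofPred_eq] at h
    change (_ ↔ _)
    refine Iff.trans (iff_of_eq ?_) h
    congr 1
    funext p
    by_cases hp : p.1 = c.1.2.2.2
    · simp [joint, hp]
    · have hne : Fin.ofNat (T + 1) (c.1.2.2.1 p.1) ≠ Fin.ofNat (T + 1) (c.1.2.2.1 c.1.2.2.2) := by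
        intro heq
        apply hp
        apply c.2.injective
        have := congrArg Fin.val heq
        simpa [Fin.ofNat, Nat.mod_eq_of_lt (hTs c hc _)] using this
      rw [Function.update_of_ne hne]
      simp [joint, hp]
  · exact ⟨(hae (Fin.ofNat (T + 1) i)).1, (hae (Fin.ofNat (T + 1) i)).2.1⟩

theorem IsGenericallyStableContent.exists_indiscernible_exchange [Nonempty M] [Finite α] [Finite β]
    {m : Set (α → M) → ℝ} (hm : IsGenericallyStableContent L N m) (hNIP : IsNIP L M)
    (hN : IsElementarySet L N)
    (hsat : SetSaturatedOfCard L N (Cardinal.lift.{w} (Order.succ (cardT L))))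
    {P : Set (α ⊕ β → M)} (hP : (∅ : Set M).Definable L P) (b : β → M) {ε : ℝ} (hε : 0 < ε)
    (hb : ∀ ρ : Set (β → M), N.Definable L ρ → b ∈ ρ →
      ε ≤ m {x | Sum.elim x b ∈ P ∧ ∃ y, y ∈ ρ ∧ Sum.elim x y ∉ P}) :
    ∃ (w : ℚ → (α ⊕ α) → M) (y : β → M), IsIndiscernibleOver L ∅ w ∧
      ∀ c, joint w y ∈ exchangeSet (L := L) P c := by
  classical
  obtain ⟨v, hv⟩ := hm.exists_exchange hNIP hN hsat hP b hε hb
  refine exists_indiscernible hsat (fun i j => v (Sum.inl (i, j))) (exchangeSet P)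
    (definable_exchangeSet hP) fun K F q hq => ?_
  let F' : Finset ℚ := F ∪ K.toLeft.biUnion fun c => Finset.univ.image c.1.2.2.1
  let h : ℚ → ℕ := fun r => (F'.filter (· < r)).card
  have hh : StrictMonoOn h F' := by
    intro r hr r' _ hrr'
    refine Finset.card_lt_card (Finset.ssubset_iff_of_subset ?_ |>.2 ⟨r, ?_, ?_⟩)
    · exact Finset.monotone_filter_right _ fun x _ hx => lt_trans hx hrr'
    · exact Finset.mem_filter.2 ⟨hr, hrr'⟩
    · simp
  refine ⟨h, hh.mono (Finset.coe_subset.2 Finset.subset_union_left), fun j => v (Sum.inr j), ?_⟩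
  rintro (c | i) hc
  · have hs : StrictMono (q ∘ h ∘ c.1.2.2.1) := by
      have hmem : ∀ l, c.1.2.2.1 l ∈ F' := fun l => Finset.mem_union_right _
        (Finset.mem_biUnion.2 ⟨c, Finset.mem_toLeft.2 hc,
          Finset.mem_image_of_mem _ (Finset.mem_univ l)⟩)
      exact fun l l' hll' => hq (hh (hmem l) (hmem l') (c.2 hll'))
    exact hv (Sum.inl ⟨⟨c.1.1, c.1.2.1, q ∘ h ∘ c.1.2.2.1, c.1.2.2.2⟩, hs⟩)
  · exact hv (Sum.inr (q (h i)))

end Exchange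

section Distality

variable {L} {N : Set M} {α β : Type}

variable (L) in
/-- The sequence `g` is indiscernible along the increasing sequences of elements of `W`. -/
def IndiscernibleOn (W : Set ℚ) (g : ℚ → α → M) : Prop :=
  ∀ (n : ℕ) (s t : Fin n → ℚ), StrictMono s → StrictMono t → (∀ i, s i ∈ W) → (∀ i, t i ∈ W) →
    ∀ θ : L.Formula (Fin n × α),
      θ.Realize (fun p => g (s p.1) p.2) ↔ θ.Realize (fun p => g (t p.1) p.2)

theorem IndiscernibleOn.mono {W W' : Set ℚ} {g : ℚ → α → M} (h : IndiscernibleOn L W g)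
    (hW : W' ⊆ W) : IndiscernibleOn L W' g :=
  fun n s t hs ht hsW htW => h n s t hs ht (fun i => hW (hsW i)) fun i => hW (htW i)

theorem IndiscernibleOn.along {W : Set ℚ} {g : ℚ → α → M} (h : IndiscernibleOn L W g)
    {ι : Type*} {r : ι → ι → Prop} {K : ι → ULift.{w} α → M} (p : ι → ℚ)
    (hK : ∀ i, K i = g (p i) ∘ ULift.down) (hp : ∀ i, p i ∈ W) (hr : ∀ i j, r i j → p i < p j) :
    IsIndiscernibleAlongOver L r ∅ K := by
  obtain rfl : K = fun i => g (p i) ∘ ULift.down := funext hK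
  refine isIndiscernibleAlongOver_empty_iff.2 fun n s t hs ht θ => ?_
  have := h n (p ∘ s) (p ∘ t) (fun i j hij => hr _ _ (hs i j hij))
    (fun i j hij => hr _ _ (ht i j hij)) (fun i => hp _) (fun i => hp _)
    (θ.relabel (Prod.map id ULift.down))
  simpa only [Formula.realize_relabel] using! this

theorem IndiscernibleOn.of_along {W : Set ℚ} {g : ℚ → α → M} {ι : Type*} {r : ι → ι → Prop}
    {K : ι → ULift.{w} α → M} (h : IsIndiscernibleAlongOver L r ∅ K) (p : ι → ℚ)
    (hK : ∀ i, K i = g (p i) ∘ ULift.down) (hp : ∀ x ∈ W, ∃ i, p i = x)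
    (hr : ∀ i j, p i < p j → r i j) : IndiscernibleOn L W g := by
  obtain rfl : K = fun i => g (p i) ∘ ULift.down := funext hK
  intro n s t hs ht hsW htW θ
  choose s' hs' using fun i => hp _ (hsW i)
  choose t' ht' using fun i => hp _ (htW i)
  have := isIndiscernibleAlongOver_empty_iff.1 h n s' t'
    (fun i j hij => hr _ _ (by rw [hs', hs']; exact hs hij))
    (fun i j hij => hr _ _ (by rw [ht', ht']; exact ht hij))
    (θ.relabel (Prod.map id ULift.up))
  simp only [Formula.realize_relabel] at this
  convert! this using 2 <;>
  · funext i
    simp [hs', ht']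

/-- Two points filling distinct cuts of a dense sequence of a distal theory
may be added simultaneously. -/
theorem TheoryDistal.indiscernibleOn_insert_insert (hd : TheoryDistal L M) {W : Set ℚ}
    (hW : ∀ x y : ℚ, x < y → ∃ z ∈ W, x < z ∧ z < y) {g : ℚ → α → M} {t t' : ℚ} (htt' : t < t')
    (ht : t ∉ W) (ht' : t' ∉ W) (h : IndiscernibleOn L (insert t W) g)
    (h' : IndiscernibleOn L (insert t' W) g) :
    IndiscernibleOn L (insert t (insert t' W)) g := by
  let κ := ULift.{w} W
  let p : κ → ℚ := fun q => q.down.1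
  have hpW : ∀ i, p i ∈ W := fun i => i.down.2
  have hlt : ∀ i j : κ, i < j ↔ p i < p j := fun i j => Iff.rfl
  have hbetween : ∀ x y : ℚ, x < y → ∃ z : κ, x < p z ∧ p z < y := by
    intro x y hxy
    obtain ⟨z, hz, hxz, hzy⟩ := hW x y hxy
    exact ⟨⟨z, hz⟩, hxz, hzy⟩
  have hdense : DenselyOrdered κ := ⟨fun i j hij => hbetween (p i) (p j) hij⟩
  have hcut : ∀ x ∉ W, IsDedekindCut {i : κ | p i < x} := by
    intro x hx
    refine ⟨fun i j hji hi => lt_of_le_of_lt (show p j ≤ p i from hji) hi, ?_, fun i hi => ?_, ?_,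
      fun i hi => ?_⟩
    · obtain ⟨z, -, hz⟩ := hbetween (x - 1) x (by linarith)
      exact ⟨z, hz⟩
    · obtain ⟨z, hz, hz'⟩ := hbetween _ _ hi
      exact ⟨z, hz', hz⟩
    · obtain ⟨z, hz, -⟩ := hbetween x (x + 1) (by linarith)
      exact ⟨z, hz.le.not_gt⟩
    · have hxi : x < p i := lt_of_le_of_ne (not_lt.1 hi) fun h => hx (h ▸ hpW i)
      obtain ⟨z, hz, hz'⟩ := hbetween _ _ hxi
      exact ⟨z, hz.le.not_gt, hz'⟩
  have hge : ∀ x ∉ W, ∀ i, ¬ p i < x → x < p i := fun x hx i hi =>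
    lt_of_le_of_ne (not_lt.1 hi) fun h => hx (h ▸ hpW i)
  have hss : ({i : κ | p i < t} : Set κ) ⊂ {i | p i < t'} := by
    refine ⟨fun i (hi : p i < t) => hi.trans htt', fun hsub => ?_⟩
    obtain ⟨z, hz, hz'⟩ := hbetween t t' htt'
    exact hz.not_gt (hsub hz')
  let J : κ → ULift.{w} α → M := fun i => g (p i) ∘ ULift.down
  have hJ : IsIndiscernibleOver L ∅ J :=
    h.along p (fun _ => rfl) (fun i => mem_insert_of_mem _ (hpW i)) fun _ _ hij => hij
  have hfill : ∀ x ∉ W, IndiscernibleOn L (insert x W) g →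
      FillsCut L ∅ J {i | p i < x} (g x ∘ ULift.down) := by
    intro x hx hind
    refine hind.along (Sum.elim p fun _ => x) ?_ ?_ ?_
    · rintro (i | i) <;> rfl
    · rintro (i | i)
      · exact mem_insert_of_mem _ (hpW i)
      · exact mem_insert _ _
    · rintro (i | i) (j | j) hij
      · exact hij
      · exact hij
      · exact hge x hx j hij
      · exact (ssubset_irrefl _ hij).elim
  have hEM : SameEMTypeOver L ∅ J J := by
    intro n s t hs ht
    exact hJ n s t (fun i j hij => hs hij) (fun i j hij => ht hij)
  have hpoly := hd κ (ULift.{w} α) inferInstance J hJ κ inferInstance hdense J hJ hEM _ _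
    (hcut t ht) (hcut t' ht') hss.ne _ _ (hfill t ht h) (hfill t' ht' h')
  refine IndiscernibleOn.of_along hpoly (Sum.elim p fun x => if x then t else t') ?_ ?_ ?_
  · rintro (i | _ | _) <;> rfl
  · rintro x (rfl | rfl | hx)
    · exact ⟨Sum.inr true, rfl⟩
    · exact ⟨Sum.inr false, rfl⟩
    · exact ⟨Sum.inl ⟨x, hx⟩, rfl⟩
  · rintro (i | i) (j | j) hij
    · exact hij
    · cases j <;> exact hij
    · cases i
      · exact hij.not_gt
      · exact hij.not_gt
    · cases i <;> cases j
      · exact (lt_irrefl _ hij).elim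
      · exact (htt'.not_gt hij).elim
      · exact hss
      · exact (lt_irrefl _ hij).elim

/-- In a distal theory, indiscernibility on a dense set together with at most one further point
implies indiscernibility everywhere. -/
theorem TheoryDistal.indiscernibleOn_univ (hd : TheoryDistal L M) {W : Set ℚ}
    (hW : ∀ x y : ℚ, x < y → ∃ z ∈ W, x < z ∧ z < y) {g : ℚ → α → M}
    (h : ∀ t, IndiscernibleOn L (insert t W) g) : IndiscernibleOn L univ g := by
  classical
  have key : ∀ (n : ℕ) (F : Finset ℚ), F.card = n → IndiscernibleOn L (W ∪ F) g := by
    intro n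
    induction n using Nat.strong_induction_on with
    | _ n ih =>
      rintro F rfl
      by_cases hF : F.card ≤ 1
      · obtain ⟨t, ht⟩ := Finset.card_le_one_iff_subset_singleton.1 hF
        refine (h t).mono ?_
        rintro x (hx | hx)
        · exact mem_insert_of_mem _ hx
        · exact Or.inl (Finset.mem_singleton.1 (ht hx))
      by_cases hFW : ∃ t ∈ F, t ∈ W
      · obtain ⟨t, htF, htW⟩ := hFW
        refine (ih _ (Finset.card_erase_lt_of_mem htF) _ rfl).mono ?_
        rintro x (hx | hx)
        · exact Or.inl hx
        · by_cases hxt : x = t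
          · exact Or.inl (hxt ▸ htW)
          · exact Or.inr (Finset.mem_erase.2 ⟨hxt, hx⟩)
      · push Not at hF hFW
        obtain ⟨a, ha, b, hb, hab⟩ := Finset.one_lt_card.1 hF
        obtain ⟨t, ht, t', ht', htt'⟩ : ∃ t ∈ F, ∃ t' ∈ F, t < t' := by
          rcases hab.lt_or_gt with hab | hab
          · exact ⟨a, ha, b, hb, hab⟩
          · exact ⟨b, hb, a, ha, hab⟩
        have hW' : ∀ x y : ℚ, x < y →
            ∃ z ∈ W ∪ ((F.erase t).erase t' : Finset ℚ), x < z ∧ z < y := fun x y hxy =>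
          (hW x y hxy).imp fun z hz => ⟨Or.inl hz.1, hz.2⟩
        refine (hd.indiscernibleOn_insert_insert hW' htt' ?_ ?_
          ((ih _ (Finset.card_erase_lt_of_mem ht') _ rfl).mono ?_)
          ((ih _ (Finset.card_erase_lt_of_mem ht) _ rfl).mono ?_)).mono ?_
        · rintro (hx | hx)
          · exact hFW t ht hx
          · simp at hx
        · rintro (hx | hx)
          · exact hFW t' ht' hx
          · simp at hx
        · rintro x (rfl | hx | hx)
          · exact Or.inr (by simp [ht, htt'.ne])
          · exact Or.inl hx
          · exact Or.inr (by simp at hx ⊢; tauto)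
        · rintro x (rfl | hx | hx)
          · exact Or.inr (by simp [ht', htt'.ne'])
          · exact Or.inl hx
          · exact Or.inr (by simp at hx ⊢; tauto)
        · rintro x (hx | hx)
          · exact Or.inr (Or.inr (Or.inl hx))
          · by_cases hxt : x = t
            · exact Or.inl hxt
            · by_cases hxt' : x = t'
              · exact Or.inr (Or.inl hxt')
              · exact Or.inr (Or.inr (Or.inr (by simp at hx ⊢; tauto)))
  intro n s t hs ht _ _
  exact key _ (Finset.univ.image s ∪ Finset.univ.image t) rfl n s t hs ht
    (fun i => Or.inr (by simp)) (fun i => Or.inr (by simp))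

/-- In a distal theory an indiscernible sequence whose terms may be exchanged one at a time
may be alternated with the exchanged terms. -/
theorem TheoryDistal.not_exchange (hd : TheoryDistal L M) (hNIP : IsNIP L M) [Finite α] [Finite β]
    {P : Set (α ⊕ β → M)} (hP : (∅ : Set M).Definable L P) {w : ℚ → (α ⊕ α) → M} {y : β → M}
    (hw : IsIndiscernibleOver L ∅ w) (hwy : ∀ c, joint w y ∈ exchangeSet (L := L) P c) : False := by
  classical
  let D : Set ℚ := {x | ¬ ∃ z : ℤ, x = z}
  let g : ℚ → α → M := fun x => if x ∈ D then w x ∘ Sum.inl else w x ∘ Sum.inr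
  have hgD : ∀ x ∈ D, g x = w x ∘ Sum.inl := fun x hx => if_pos hx
  have hgZ : ∀ x ∉ D, g x = w x ∘ Sum.inr := fun x hx => if_neg hx
  have hDdense : ∀ x y : ℚ, x < y → ∃ z ∈ D, x < z ∧ z < y := by
    intro x y hxy
    obtain ⟨z, hxz, hz⟩ := exists_between (lt_min hxy (Int.lt_floor_add_one x))
    refine ⟨z, ?_, hxz, hz.trans_le (min_le_left _ _)⟩
    rintro ⟨k, rfl⟩
    have h₁ : ⌊x⌋ < k := by exact_mod_cast (Int.floor_le x).trans_lt hxz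
    have h₂ : k < ⌊x⌋ + 1 := by exact_mod_cast hz.trans_le (min_le_right _ _)
    lia
  have hga : ∀ (t : ℚ) (n : ℕ) (s : Fin n → ℚ), StrictMono s → (∀ i, s i ∈ insert t D) →
      ∀ θ : L.Formula (Fin n × α), θ.Realize (fun p => g (s p.1) p.2) ↔
        θ.Realize fun p => w (s p.1) (Sum.inl p.2) := by
    intro t n s hs hsD θ
    by_cases hall : ∀ i, s i ∈ D
    · simp only [hgD _ (hall _), Function.comp_apply]
    · push Not at hall
      obtain ⟨i, hi⟩ := hall
      have hit : s i = t := (hsD i).resolve_right hi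
      refine Iff.trans ?_ (hwy (Sum.inl ⟨⟨n, θ, s, i⟩, hs⟩))
      refine iff_of_eq (congrArg θ.Realize (funext fun p => ?_))
      by_cases hp : p.1 = i
      · simp [hp, hgZ _ hi, joint]
      · have : s p.1 ∈ D := (hsD p.1).resolve_left fun h => hp (hs.injective (h.trans hit.symm))
        simp [hp, hgD _ this, joint]
  have hind : IndiscernibleOn L univ g := by
    refine hd.indiscernibleOn_univ hDdense fun t n s s' hs hs' hsD hsD' θ => ?_
    rw [hga t n s hs hsD, hga t n s' hs' hsD']
    exact isIndiscernibleAlongOver_empty_iff.1 (hw.comp_right Sum.inl) n s s'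
      (fun i j hij => hs hij) (fun i j hij => hs' hij) θ
  let r : ℕ → ℚ := fun i => (i + 1) / 2
  refine hNIP.not_alternating hP (w := fun i => g (r i)) (y := y) ?_ fun i => ?_
  · refine isIndiscernibleAlongOver_empty_iff.2 fun n s t hs ht θ => ?_
    have hr : StrictMono r := fun i j hij => by
      have : (i : ℚ) < j := by exact_mod_cast hij
      simp only [r]
      linarith
    exact hind n (r ∘ s) (r ∘ t) (fun i j hij => hr (hs i j hij)) (fun i j hij => hr (ht i j hij))
      (fun _ => mem_univ _) (fun _ => mem_univ _) θ
  · have hi := hwy (Sum.inr (r i))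
    have hmem : r i ∈ D ↔ Even i := by
      rw [← Nat.not_odd_iff_even]
      refine not_congr ⟨fun ⟨z, hz⟩ => ?_, fun ⟨k, hk⟩ => ⟨k + 1, ?_⟩⟩
      · have : ((i : ℤ) : ℚ) + 1 = 2 * z := by
          rw [← hz]
          simp only [r, Int.cast_natCast]
          ring
        have : (i : ℤ) + 1 = 2 * z := by exact_mod_cast this
        rw [← Int.odd_coe_nat]
        exact ⟨z - 1, by lia⟩
      · simp only [r, hk]
        push_cast
        ring
    rw [← hmem]
    constructor
    · intro h
      by_contra hD
      rw [hgZ _ hD] at h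
      exact hi.2 h
    · intro hD
      rw [hgD _ hD]
      exact hi.1

end Distality

section Smooth

variable {L} {N : Set M} {γ : Type w}

theorem exists_formula_of_definable {S : Set (γ → M)} (hS : N.Definable L S) :
    ∃ (k : ℕ) (ψ : L.Formula (γ ⊕ Fin k)) (c : Fin k → M), (∀ i, c i ∈ N) ∧
      S = {x | (ψ.relabel (Sum.map id c)).Realize (Sum.elim x id)} := by
  obtain ⟨k, d, R, hd, hR, hSR⟩ := exists_fibre_of_definable hS
  obtain ⟨ψ, rfl⟩ := empty_definable_iff.1 hR
  refine ⟨k, ψ.relabel Sum.swap, d, hd, ?_⟩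
  ext x
  rw [hSR, mem_ofPred_eq, mem_ofPred_eq, Formula.realize_relabel, Formula.realize_relabel]
  congr! 1
  funext i
  cases i <;> rfl

namespace KeislerMeasure

variable (μ : KeislerMeasure L M γ)

open Classical in
/-- The measure of a definable set. -/
noncomputable def setVal (S : Set (γ → M)) : ℝ :=
  if h : ∃ φ : L.Formula (γ ⊕ M), S = {x | φ.Realize (Sum.elim x id)} then μ.val h.choose else 0

theorem setVal_realize (φ : L.Formula (γ ⊕ M)) :
    μ.setVal {x | φ.Realize (Sum.elim x id)} = μ.val φ := by
  have h : ∃ ψ : L.Formula (γ ⊕ M),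
    {x : γ → M | φ.Realize (Sum.elim x id)} = {x | ψ.Realize (Sum.elim x id)} := ⟨φ, rfl⟩
  rw [setVal, dif_pos h]
  exact μ.congr _ _ fun x => (Set.ext_iff.1 h.choose_spec x).symm

theorem setVal_nonneg (S : Set (γ → M)) : 0 ≤ μ.setVal S := by
  rw [setVal]
  split_ifs
  · exact μ.nonneg _
  · exact le_rfl

theorem setVal_univ : μ.setVal univ = 1 := by
  have : (univ : Set (γ → M)) = {x | (⊤ : L.Formula (γ ⊕ M)).Realize (Sum.elim x id)} := by
    ext x
    simp
  rw [this, setVal_realize]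
  exact μ.total _ fun x => by simp

variable {μ}

theorem setVal_union {S S' : Set (γ → M)} (hS : (univ : Set M).Definable L S)
    (hS' : (univ : Set M).Definable L S') (h : Disjoint S S') :
    μ.setVal (S ∪ S') = μ.setVal S + μ.setVal S' := by
  obtain ⟨_, ψ, c, -, rfl⟩ := exists_formula_of_definable hS
  obtain ⟨_, ψ', c', -, rfl⟩ := exists_formula_of_definable hS'
  have : ∀ φ φ' : L.Formula (γ ⊕ M), {x : γ → M | φ.Realize (Sum.elim x id)} ∪
      {x | φ'.Realize (Sum.elim x id)} = {x | (φ ⊔ φ').Realize (Sum.elim x id)} := by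
    intro φ φ'
    ext x
    simp
  rw [this, setVal_realize, setVal_realize, setVal_realize]
  exact μ.add _ _ _ (fun x => by simp) fun x hx => disjoint_left.1 h hx.1 hx.2

theorem setVal_mono {S S' : Set (γ → M)} (hS : (univ : Set M).Definable L S)
    (hS' : (univ : Set M).Definable L S') (h : S ⊆ S') : μ.setVal S ≤ μ.setVal S' := by
  rw [← union_sdiff_cancel h, setVal_union hS (hS'.sdiff hS) disjoint_sdiff_right]
  linarith [μ.setVal_nonneg (S' \ S)]

theorem val_not (μ : KeislerMeasure L M γ) (φ : L.Formula (γ ⊕ M)) :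
    μ.val φ + μ.val φ.not = 1 := by
  rw [← μ.add φ φ.not ⊤ (fun x => by simp [em]) (fun x => by simp),
    μ.total _ fun x => by simp]

theorem setVal_eq_of_agree {μ μ' : KeislerMeasure L M γ} (h : MeasAgreeOn L μ' μ N)
    {S : Set (γ → M)} (hS : N.Definable L S) : μ'.setVal S = μ.setVal S := by
  obtain ⟨k, ψ, c, hc, rfl⟩ := exists_formula_of_definable hS
  rw [setVal_realize, setVal_realize]
  exact h k ψ c hc

end KeislerMeasure

/-- The push-forward of a generically stable measure along a finite tuple of coordinates. -/
theorem MeasGenericallyStableOver.isGenericallyStableContent {μ : KeislerMeasure L M γ}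
    (hgs : MeasGenericallyStableOver L μ N) {α : Type} (f : α → γ) :
    IsGenericallyStableContent L N fun S : Set (α → M) => μ.setVal {x | x ∘ f ∈ S} where
  nonneg S := μ.setVal_nonneg _
  univ_eq := μ.setVal_univ
  union S S' hS hS' h := KeislerMeasure.setVal_union (hS.preimage_comp f) (hS'.preimage_comp f)
    (h.preimage fun x : γ → M => x ∘ f)
  finSat S hS hpos := by
    obtain ⟨k, ψ, c, -, hψ⟩ := exists_formula_of_definable (hS.preimage_comp f)
    change 0 < μ.setVal ((fun x : γ → M => x ∘ f) ⁻¹' S) at hpos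
    rw [hψ, KeislerMeasure.setVal_realize] at hpos
    obtain ⟨a, haN, ha⟩ := hgs.2.2 _ hpos
    exact ⟨a ∘ f, (Set.ext_iff.1 hψ a).2 ha, fun i => haN _⟩
  definable ζ _ R hR ε hε := by
    obtain ⟨k, d, R', hd, hR', hRR'⟩ := exists_fibre_of_definable hR
    obtain ⟨φ, rfl⟩ := empty_definable_iff.1 hR'
    obtain ⟨n, ⟨e⟩⟩ := Finite.exists_equiv_fin (Fin k ⊕ ζ)
    let b : (ζ → M) → Fin n → M := fun z => Sum.elim d z ∘ e.symm
    let φ' : L.Formula (γ ⊕ Fin n) := φ.relabel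
      (Sum.elim (fun i => Sum.inr (e (Sum.inl i)))
        (Sum.elim (fun j => Sum.inr (e (Sum.inr j))) fun a => Sum.inl (f a)))
    have hφ' : ∀ z, μ.setVal {x | Sum.elim z (x ∘ f) ∈ R} =
        μ.val (φ'.relabel (Sum.map id (b z))) := by
      intro z
      rw [← KeislerMeasure.setVal_realize]
      congr 1
      ext x
      rw [mem_ofPred_eq, mem_ofPred_eq, hRR', mem_ofPred_eq, Formula.realize_relabel,
        Formula.realize_relabel]
      congr! 1
      funext i
      rcases i with i | i | i <;> simp [b]
    obtain ⟨m, ψ, hcov, hψ⟩ := hgs.2.1 n φ' ε hε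
    refine ⟨range fun j => {z | (ψ j).Realize (Sum.elim (b z) Subtype.val)}, finite_range _, ?_,
      fun z => ?_, ?_⟩
    · rintro _ ⟨j, rfl⟩
      refine definable_comap (A := N) (R := {v | (ψ j).Realize v})
        ((empty_definable_iff.2 ⟨ψ j, rfl⟩).mono (empty_subset _))
        (fun z => Sum.elim (b z) Subtype.val) fun i => ?_
      rcases i with i | i
      · rcases hi : e.symm i with l | l
        · exact Or.inr ⟨d l, hd l, fun v => by simp [b, hi]⟩
        · exact Or.inl ⟨l, fun v => by simp [b, hi]⟩
      · exact Or.inr ⟨i, i.2, fun v => rfl⟩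
    · obtain ⟨j, hj⟩ := hcov (b z)
      exact ⟨_, ⟨j, rfl⟩, hj⟩
    · rintro _ ⟨j, rfl⟩ z hz z' hz'
      have := hψ j _ _ hz hz'
      rwa [← hφ', ← hφ'] at this

theorem exists_fibre_of_formula (φ : L.Formula (γ ⊕ M)) :
    ∃ (α β : Type) (_ : Finite α) (_ : Finite β) (f : α → γ) (b : β → M) (P : Set (α ⊕ β → M)),
      (∅ : Set M).Definable L P ∧
      {x : γ → M | φ.Realize (Sum.elim x id)} = {x | Sum.elim (x ∘ f) b ∈ P} := by
  obtain ⟨m, ψ, g, hg⟩ := exists_formula_fin (M := M) φ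
  let α := {i : Fin m // ∃ c, g i = Sum.inl c}
  let β := {i : Fin m // ∃ c, g i = Sum.inr c}
  choose f hf using fun i : α => i.2
  choose b hb using fun i : β => i.2
  have hg' : ∀ i, ∃ j : α ⊕ β, g i = Sum.map f b j := by
    intro i
    rcases hi : g i with c | c
    · exact ⟨Sum.inl ⟨i, c, hi⟩, hi.symm.trans (hf ⟨i, c, hi⟩)⟩
    · exact ⟨Sum.inr ⟨i, c, hi⟩, hi.symm.trans (hb ⟨i, c, hi⟩)⟩
  choose g' hg' using hg'
  refine ⟨α, β, inferInstance, inferInstance, f, b, {v | (ψ.relabel g').Realize v},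
    empty_definable_iff.2 ⟨_, rfl⟩, ?_⟩
  ext x
  rw [mem_ofPred_eq, mem_ofPred_eq, mem_ofPred_eq, hg, Formula.realize_relabel]
  congr! 1
  funext i
  rw [Function.comp_apply, hg', Function.comp_apply]
  cases g' i <;> rfl

theorem MeasGenericallyStableOver.val_le_of_agree [Nonempty M] (hNIP : IsNIP L M)
    (hd : TheoryDistal L M) (hN : IsElementarySet L N)
    (hsat : SetSaturatedOfCard L N (Cardinal.lift.{w} (Order.succ (cardT L))))
    {μ μ' : KeislerMeasure L M γ} (hgs : MeasGenericallyStableOver L μ N)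
    (h : MeasAgreeOn L μ' μ N) (φ : L.Formula (γ ⊕ M)) : μ.val φ ≤ μ'.val φ := by
  by_contra! hlt
  obtain ⟨α, β, _, _, f, b, P, hP, hφ⟩ := exists_fibre_of_formula φ
  have hm := hgs.isGenericallyStableContent f
  obtain ⟨w, y, hw, hwy⟩ := hm.exists_indiscernible_exchange hNIP hN hsat hP b (sub_pos.2 hlt) (by
    intro ρ hρ hbρ
    let Y : Set (α → M) := {x | ∀ y, y ∈ ρ → Sum.elim x y ∈ P}
    let Q : Set (α → M) := {x | Sum.elim x b ∈ P}
    have hQ : (univ : Set M).Definable L Q :=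
      definable_comap (hP.mono (empty_subset _)) (fun x => Sum.elim x b) fun i => by
        cases i with
        | inl i => exact Or.inl ⟨i, fun v => rfl⟩
        | inr i => exact Or.inr ⟨b i, mem_univ _, fun v => rfl⟩
    have hY : N.Definable L Y := by
      have : N.Definable L {x : α → M | ∃ y : β → M, y ∈ ρ ∧ Sum.elim x y ∉ P} :=
        Definable.exists_of_finite
          (S := {u : α ⊕ β → M | u ∘ Sum.inr ∈ ρ ∧ u ∉ P})
          ((hρ.preimage_comp Sum.inr).inter (hP.mono (empty_subset _)).compl)
      convert! this.compl using 1
      ext x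
      simp [Y]
    have hYQ : Y ⊆ Q := fun x hx => hx b hbρ
    have hset : {x : α → M | Sum.elim x b ∈ P ∧ ∃ y, y ∈ ρ ∧ Sum.elim x y ∉ P} = Q \ Y := by
      ext x
      simp [Q, Y]
    have hYu := hY.mono (subset_univ N)
    have h₁ := hm.inter_add_diff hYu hQ
    have h₂ : μ'.setVal {x | x ∘ f ∈ Y} = μ.setVal {x | x ∘ f ∈ Y} :=
      KeislerMeasure.setVal_eq_of_agree h (hY.preimage_comp f)
    have h₃ : μ'.setVal {x | x ∘ f ∈ Y} ≤ μ'.setVal {x | x ∘ f ∈ Q} :=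
      KeislerMeasure.setVal_mono (hYu.preimage_comp f) (hQ.preimage_comp f) fun x hx => hYQ hx
    have h₄ : μ'.setVal {x | x ∘ f ∈ Q} = μ'.val φ := by
      rw [← KeislerMeasure.setVal_realize, hφ]; rfl
    have h₅ : μ.setVal {x | x ∘ f ∈ Q} = μ.val φ := by
      rw [← KeislerMeasure.setVal_realize, hφ]; rfl
    rw [inter_eq_self_of_subset_right hYQ] at h₁
    rw [hset]
    linarith)
  exact hd.not_exchange hNIP hP hw hwy

theorem MeasGenericallyStableOver.val_eq_of_agree (hNIP : IsNIP L M)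
    (hd : TheoryDistal L M) (hN : IsElementarySet L N)
    (hsat : SetSaturatedOfCard L N (Cardinal.lift.{w} (Order.succ (cardT L))))
    {μ μ' : KeislerMeasure L M γ} (hgs : MeasGenericallyStableOver L μ N)
    (h : MeasAgreeOn L μ' μ N) (φ : L.Formula (γ ⊕ M)) : μ'.val φ = μ.val φ := by
  have h₁ := μ.val_not φ
  have h₂ := μ'.val_not φ
  rcases isEmpty_or_nonempty M with hM | hM
  · by_cases hφ : ∀ x : γ → M, φ.Realize (Sum.elim x id)
    · rw [μ.total φ hφ, μ'.total φ hφ]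
    · obtain ⟨x, hx⟩ := not_forall.1 hφ
      have hnot : ∀ x : γ → M, φ.not.Realize (Sum.elim x id) := fun x' => by
        rwa [Subsingleton.elim x' x, Formula.realize_not]
      rw [μ.total _ hnot] at h₁
      rw [μ'.total _ hnot] at h₂
      linarith
  · have h₃ := hgs.val_le_of_agree hNIP hd hN hsat h φ
    have h₄ := hgs.val_le_of_agree hNIP hd hN hsat h φ.not
    linarith

end Smooth

/-- If `T` is NIP and distal, then every generically stable Keisler
measure over a `|T|⁺`-saturated model `N` is weakly orthogonal to every type over
`N`, hence smooth. -/
theorem statement_2 {γ : Type w} (hNIP : IsNIP L M) (hdistal : TheoryDistal L M)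
    (N : Set M) (hN : IsElementarySet L N)
    (hsatN : SetSaturatedOfCard L N (Cardinal.lift.{w} (Order.succ (cardT L))))
    (μ : KeislerMeasure L M γ) (hgs : MeasGenericallyStableOver L μ N) :
    (∀ (δ : Type w) (a : δ → M) (μ₁ μ₂ : KeislerMeasure L M γ),
        MeasAgreeOn L μ₁ μ N → MeasAgreeOn L μ₂ μ N →
        MeasAgreeOn L μ₁ μ₂ (N ∪ Set.range a)) ∧
    MeasSmoothOver L μ N := by
  have hsmooth : MeasSmoothOver L μ N := fun μ₁ μ₂ h₁ h₂ φ => by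
    rw [hgs.val_eq_of_agree hNIP hdistal hN hsatN h₁, hgs.val_eq_of_agree hNIP hdistal hN hsatN h₂]
  exact ⟨fun _ _ μ₁ μ₂ h₁ h₂ _ φ c _ => hsmooth μ₁ μ₂ h₁ h₂ _, hsmooth⟩

end Paper
end

section
/- Let T be a complete NIP theory. Let I be a distal indiscernible sequence indexed by a dense linear order, and let c_0, …, c_{n−1} be pairwise distinct Dedekind cuts of I. If for each i < n the tuple a_i fills c_i, then the family (a_i)_{i<n} is I-independent: the sequence obtained from I by inserting every a_i into its cut c_i is indiscernible. -/
/-!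
Common model-theoretic definitions: indiscernible sequences, NIP, cuts,
distality, Keisler measures, invariant types, etc., following the paper
"Distal and non-distal NIP theories".
-/

namespace Paper

open FirstOrder Language Set Cardinal

universe u v w

variable (L : FirstOrder.Language.{u, v}) {M : Type w} [L.Structure M]

section InsertPoint

variable {L}

/-- Indiscernibility pulls back along maps of index sets preserving the relations. -/
theorem IsIndiscernibleAlongOver.of_map {ι κ γ : Type*} {r : ι → ι → Prop} {q : κ → κ → Prop}
    {A : Set M} {I : ι → γ → M} {J : κ → γ → M} (hJ : IsIndiscernibleAlongOver L q A J)
    (f : ι → κ) (hf : ∀ x y, r x y → q (f x) (f y)) (hIJ : ∀ x, I x = J (f x)) :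
    IsIndiscernibleAlongOver L r A I := by
  intro n s t hs ht φ
  simpa only [hIJ, Function.comp_apply] using hJ n (f ∘ s) (f ∘ t)
    (fun i j hij => hf _ _ (hs i j hij)) (fun i j hij => hf _ _ (ht i j hij)) φ

/-- The linear order obtained from `ι` by inserting one point into the cut `c`. -/
def InsertPoint {ι : Type w} [LinearOrder ι] (c : Set ι) (_ : IsLowerSet c) : Type w :=
  ι ⊕ Unit

theorem isStrictTotalOrder_cutRel {ι : Type*} [LinearOrder ι] {c : Set ι} (hc : IsLowerSet c) :
    IsStrictTotalOrder (ι ⊕ Unit) (cutRel fun _ : Unit => c) where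
  irrefl := by
    rintro (x | x) <;> simp [cutRel]
  trans := by
    rintro (x | x) (y | y) (z | z) h₁ h₂ <;> simp only [cutRel] at h₁ h₂ ⊢
    · exact h₁.trans h₂
    · exact hc h₁.le h₂
    · exact lt_of_not_ge fun h => h₂ (hc h h₁)
    · exact absurd h₂ (ssubset_irrefl _)
    · exact fun h => h₁ (hc h₂.le h)
    · exact absurd h₂ h₁
    · exact absurd h₁ (ssubset_irrefl _)
    · exact h₁
  trichotomous := by
    rintro (x | x) (y | y) h₁ h₂ <;> simp only [cutRel] at h₁ h₂ ⊢
    · exact congrArg Sum.inl (le_antisymm (not_lt.1 h₂) (not_lt.1 h₁))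
    · exact absurd h₁ h₂
    · exact absurd h₂ h₁

noncomputable instance {ι : Type w} [LinearOrder ι] (c : Set ι) (hc : IsLowerSet c) :
    LinearOrder (InsertPoint c hc) :=
  @linearOrderOfSTO (ι ⊕ Unit) (cutRel fun _ : Unit => c) (isStrictTotalOrder_cutRel hc)
    (Classical.decRel _)

theorem InsertPoint.denselyOrdered {ι : Type w} [LinearOrder ι] [DenselyOrdered ι] {c : Set ι}
    (hc : IsDedekindCut c) : DenselyOrdered (InsertPoint c hc.1) where
  dense := by
    rintro (x | x) (y | y) h
    · obtain ⟨z, hxz, hzy⟩ := exists_between (show x < y from h)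
      exact ⟨Sum.inl z, hxz, hzy⟩
    · obtain ⟨z, hz, hxz⟩ := hc.2.2.1 x h
      exact ⟨Sum.inl z, hxz, hz⟩
    · obtain ⟨z, hz, hzy⟩ := hc.2.2.2.2 y h
      exact ⟨Sum.inl z, hz, hzy⟩
    · exact absurd (show c ⊂ c from h) (ssubset_irrefl _)

/-- The cut induced by `e` on the order obtained by inserting a point into the cut `c`. -/
def InsertPoint.cut {ι : Type w} [LinearOrder ι] (c : Set ι) (hc : IsLowerSet c) (e : Set ι) :
    Set (InsertPoint c hc) :=
  {x | Sum.elim (· ∈ e) (fun _ : Unit => c ⊂ e) x}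

theorem IsLowerSet.ssubset_of_not_ssubset {ι : Type*} [LinearOrder ι] {c e : Set ι}
    (hc : IsLowerSet c) (he : IsLowerSet e) (hne : c ≠ e) (h : ¬ c ⊂ e) : e ⊂ c :=
  ((hc.total he).resolve_left fun hce => h (hce.ssubset_of_ne hne)).ssubset_of_ne hne.symm

theorem InsertPoint.cut_ssubset {ι : Type w} [LinearOrder ι] {c : Set ι} (hc : IsLowerSet c)
    {e e' : Set ι} (h : e ⊂ e') : InsertPoint.cut c hc e ⊂ InsertPoint.cut c hc e' := by
  refine ssubset_iff_subset_not_subset.2 ⟨?_, fun h' => h.2 fun x hx => ?_⟩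
  · rintro (x | x) hx
    · exact h.1 hx
    · exact (show c ⊂ e from hx).trans h
  · exact h' (show (Sum.inl x : ι ⊕ Unit) ∈ InsertPoint.cut c hc e' from hx)

theorem InsertPoint.cut_injective {ι : Type w} [LinearOrder ι] {c : Set ι} (hc : IsLowerSet c) :
    Function.Injective (InsertPoint.cut c hc) := fun _ _ h =>
  Set.ext fun x => Set.ext_iff.1 h (Sum.inl x : ι ⊕ Unit)

theorem InsertPoint.isDedekindCut_cut {ι : Type w} [LinearOrder ι] {c e : Set ι}
    (hc : IsLowerSet c) (he : IsDedekindCut e) (hne : c ≠ e) :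
    IsDedekindCut (InsertPoint.cut c hc e) := by
  obtain ⟨hlow, ⟨x₀, hx₀⟩, hmax, ⟨y₀, hy₀⟩, hmin⟩ := he
  refine ⟨?_, ⟨(Sum.inl x₀ : ι ⊕ Unit), hx₀⟩, ?_, ⟨(Sum.inl y₀ : ι ⊕ Unit), hy₀⟩, ?_⟩
  · intro x y hyx hx
    rcases hyx.eq_or_lt with rfl | hyx
    · exact hx
    rcases x with x | x <;> rcases y with y | y
    · exact hlow (le_of_lt (show y < x from hyx)) hx
    · by_contra h
      exact hyx ((IsLowerSet.ssubset_of_not_ssubset hc hlow hne h).1 hx)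
    · exact (show c ⊂ e from hx).1 hyx
    · exact hx
  · rintro (x | x) hx
    · obtain ⟨y, hy, hxy⟩ := hmax x hx
      exact ⟨(Sum.inl y : ι ⊕ Unit), hy, hxy⟩
    · obtain ⟨y, hy, hyc⟩ := exists_of_ssubset (show c ⊂ e from hx)
      exact ⟨(Sum.inl y : ι ⊕ Unit), hy, hyc⟩
  · rintro (x | x) hx
    · obtain ⟨y, hy, hyx⟩ := hmin x hx
      exact ⟨(Sum.inl y : ι ⊕ Unit), hy, hyx⟩
    · obtain ⟨y, hyc, hy⟩ :=
        exists_of_ssubset (IsLowerSet.ssubset_of_not_ssubset hc hlow hne hx)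
      exact ⟨(Sum.inl y : ι ⊕ Unit), hy, hyc⟩

/-- If two tuples jointly fill two distinct cuts, then the second one fills the cut induced on
the sequence extended by the first one. -/
theorem FillsPolycut.fillsCut_insertPoint {ι : Type w} {γ : Type*} [LinearOrder ι] {A : Set M}
    {I : ι → γ → M} {c e : Set ι} (hc : IsLowerSet c) (he : IsLowerSet e) (hne : c ≠ e)
    {a b : γ → M}
    (h : FillsPolycut L A I (fun x : Bool => if x then c else e)
      (fun x : Bool => if x then a else b)) :
    FillsCut (ι := InsertPoint c hc) L A (Sum.elim I fun _ : Unit => a)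
      (InsertPoint.cut c hc e) b := by
  refine IsIndiscernibleAlongOver.of_map h
    (Sum.elim (Sum.elim Sum.inl fun _ : Unit => Sum.inr true) fun _ : Unit => Sum.inr false) ?_ ?_
  · rintro ((x | x) | x) ((y | y) | y) hxy
    · exact hxy
    · exact hxy
    · exact hxy
    · exact hxy
    · exact absurd (show c ⊂ c from hxy) (ssubset_irrefl _)
    · exact hxy
    · exact hxy
    · exact IsLowerSet.ssubset_of_not_ssubset hc he hne hxy
    · exact absurd hxy (ssubset_irrefl _)
  · rintro ((x | x) | x) <;> rfl

/-- If the tuples `a i.succ` jointly fill the induced cuts of the sequence extended by `a 0`,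
then all the `a i` jointly fill the original cuts. -/
theorem FillsPolycut.of_insertPoint {ι : Type w} {γ : Type*} [LinearOrder ι] {A : Set M}
    {I : ι → γ → M} {n : ℕ} {c : Fin (n + 1) → Set ι} (hc : IsLowerSet (c 0))
    {a : Fin (n + 1) → γ → M}
    (h : FillsPolycut (ι := InsertPoint (c 0) hc) L A (Sum.elim I fun _ : Unit => a 0)
      (fun i : Fin n => InsertPoint.cut (c 0) hc (c i.succ)) (fun i => a i.succ)) :
    FillsPolycut L A I c a := by
  refine IsIndiscernibleAlongOver.of_map h
    (Sum.elim (fun x => Sum.inl (Sum.inl x : ι ⊕ Unit))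
      (Fin.cases (Sum.inl (Sum.inr () : ι ⊕ Unit)) Sum.inr)) ?_ ?_
  · rintro (x | i) (y | j) hxy
    · exact hxy
    · cases j using Fin.cases <;> exact hxy
    · cases i using Fin.cases <;> exact hxy
    · cases i using Fin.cases <;> cases j using Fin.cases
      · exact hxy
      · exact hxy
      · exact fun h' => ssubset_asymm hxy h'
      · exact InsertPoint.cut_ssubset hc hxy
  · rintro (x | i)
    · rfl
    · cases i using Fin.cases <;> rfl

/-- Distality passes to a sequence extending the given one. -/
theorem IsDistalSeqOver.of_extension {ι κ γ : Type*} [LinearOrder ι] [LinearOrder κ] {A : Set M}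
    {I : ι → γ → M} {J : κ → γ → M} (hI : IsDistalSeqOver L A I) (f : ι → κ) (hf : StrictMono f)
    (hIJ : ∀ x, I x = J (f x)) : IsDistalSeqOver L A J := by
  intro μ _ _ K hK hJK
  refine hI μ _ ‹_› K hK fun n s t hs ht φ => ?_
  simpa only [hIJ, Function.comp_apply] using hJK n (f ∘ s) t (hf.comp hs) ht φ

theorem IsDistalSeqOver.fillsPolycut {γ : Type*} {A : Set M} (n : ℕ) {ι : Type w} [LinearOrder ι]
    [DenselyOrdered ι] {I : ι → γ → M} (hI : IsIndiscernibleOver L A I)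
    (hdist : IsDistalSeqOver L A I) {c : Fin n → Set ι} (hc : ∀ i, IsDedekindCut (c i))
    (hinj : Function.Injective c) {a : Fin n → γ → M} (hfill : ∀ i, FillsCut L A I (c i) (a i)) :
    FillsPolycut L A I c a := by
  induction n generalizing ι with
  | zero =>
    refine IsIndiscernibleAlongOver.of_map hI (Sum.elim id fun i => i.elim0) ?_ ?_
    · rintro (x | i) (y | j) hxy
      · exact hxy
      · exact j.elim0
      · exact i.elim0
      · exact i.elim0
    · rintro (x | i)
      · rfl
      · exact i.elim0
  | succ n ih =>
    have hne : ∀ i : Fin n, c 0 ≠ c i.succ := fun i h => Fin.succ_ne_zero i (hinj h).symm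
    have := InsertPoint.denselyOrdered (hc 0)
    refine FillsPolycut.of_insertPoint (hc 0).1
      (ih (ι := InsertPoint (c 0) (hc 0).1) (hfill 0) ?_ ?_ ?_ ?_)
    · exact hdist.of_extension (κ := InsertPoint (c 0) (hc 0).1)
        (fun x => (Sum.inl x : ι ⊕ Unit)) (fun _ _ h => h) fun _ => rfl
    · exact fun i => InsertPoint.isDedekindCut_cut (hc 0).1 (hc i.succ) (hne i)
    · exact (InsertPoint.cut_injective (hc 0).1).comp (hinj.comp (Fin.succ_injective n))
    · exact fun i => FillsPolycut.fillsCut_insertPoint (hc 0).1 (hc i.succ).1 (hne i)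
        (hdist ι _ ‹_› I hI (fun m s t hs ht φ => hI m s t (fun _ _ h => hs h)
          (fun _ _ h => ht h) φ) _ _ (hc 0) (hc i.succ) (hne i) _ _ (hfill 0) (hfill i.succ))

end InsertPoint

/-- In a distal dense indiscernible sequence, tuples filling pairwise
distinct Dedekind cuts are `I`-independent: inserting all of them simultaneously
keeps the sequence indiscernible. -/
theorem statement_12 {ι γ : Type w} [LinearOrder ι] [DenselyOrdered ι]
    (hNIP : IsNIP L M)
    (I : ι → γ → M) (hI : IsIndiscernibleOver L (∅ : Set M) I)
    (hdist : IsDistalSeqOver L (∅ : Set M) I)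
    (n : ℕ) (c : Fin n → Set ι) (hc : ∀ i, IsDedekindCut (c i))
    (hinj : Function.Injective c)
    (a : Fin n → γ → M) (hfill : ∀ i, FillsCut L (∅ : Set M) I (c i) (a i)) :
    FillsPolycut L (∅ : Set M) I c a :=
  hdist.fillsPolycut n hI hc hinj hfill

end Paper
end
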